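/- (Corollary 5.1) Let (u, v, p) be real-analytic on W × (−T, T) ⊂ ℝ² × ℝ, a solution of the incompressible Euler equations, and suppose u(x₀, 0)·v(x₀, 0) ≠ 0 for some x₀ ∈ W. Then there exist a neighborhood W′ of x₀, a time T′ ∈ (0, T], and real-analytic functions g₁₁, g₁₂, g₂₂ on W′ × (−T′, T′) with det g := g₁₁g₂₂ − g₁₂² > 0 such that for every t ∈ (−T′, T′), the triple L := v² + p, M := −uv, N := u² + p together with the metric g(·, t) satisfies the Gauss–Codazzi equations; i.e., the Euler solution defines a time-evolving two-dimensional Riemannian metric whose Gauss curvature equals p² + p(u² + v²) and whose normalized second fundamental form is (L, M, N). -/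

import Mathlib

noncomputable def pdx1 (f : ℝ × ℝ × ℝ → ℝ) (q : ℝ × ℝ × ℝ) : ℝ :=
  deriv (fun s => f (s, q.2.1, q.2.2)) q.1

noncomputable def pdx2 (f : ℝ × ℝ × ℝ → ℝ) (q : ℝ × ℝ × ℝ) : ℝ :=
  deriv (fun s => f (q.1, s, q.2.2)) q.2.1

noncomputable def pdt (f : ℝ × ℝ × ℝ → ℝ) (q : ℝ × ℝ × ℝ) : ℝ :=
  deriv (fun s => f (q.1, q.2.1, s)) q.2.2

/-- Determinant of the metric `g₁₁g₂₂ - g₁₂²`. -/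
noncomputable def detg (g11 g12 g22 : ℝ × ℝ × ℝ → ℝ) (q : ℝ × ℝ × ℝ) : ℝ :=
  g11 q * g22 q - (g12 q) ^ 2

/-- Christoffel symbol Γ¹₁₁. -/
noncomputable def Gamma1_11 (g11 g12 g22 : ℝ × ℝ × ℝ → ℝ) (q : ℝ × ℝ × ℝ) : ℝ :=
  (g22 q * pdx1 g11 q - g12 q * (2 * pdx1 g12 q - pdx2 g11 q)) / (2 * detg g11 g12 g22 q)

/-- Christoffel symbol Γ¹₁₂. -/
noncomputable def Gamma1_12 (g11 g12 g22 : ℝ × ℝ × ℝ → ℝ) (q : ℝ × ℝ × ℝ) : ℝ :=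
  (g22 q * pdx2 g11 q - g12 q * pdx1 g22 q) / (2 * detg g11 g12 g22 q)

/-- Christoffel symbol Γ¹₂₂. -/
noncomputable def Gamma1_22 (g11 g12 g22 : ℝ × ℝ × ℝ → ℝ) (q : ℝ × ℝ × ℝ) : ℝ :=
  (g22 q * (2 * pdx2 g12 q - pdx1 g22 q) - g12 q * pdx2 g22 q) / (2 * detg g11 g12 g22 q)

/-- Christoffel symbol Γ²₁₁. -/
noncomputable def Gamma2_11 (g11 g12 g22 : ℝ × ℝ × ℝ → ℝ) (q : ℝ × ℝ × ℝ) : ℝ :=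
  (-(g12 q) * pdx1 g11 q + g11 q * (2 * pdx1 g12 q - pdx2 g11 q)) / (2 * detg g11 g12 g22 q)

/-- Christoffel symbol Γ²₁₂. -/
noncomputable def Gamma2_12 (g11 g12 g22 : ℝ × ℝ × ℝ → ℝ) (q : ℝ × ℝ × ℝ) : ℝ :=
  (-(g12 q) * pdx2 g11 q + g11 q * pdx1 g22 q) / (2 * detg g11 g12 g22 q)

/-- Christoffel symbol Γ²₂₂. -/
noncomputable def Gamma2_22 (g11 g12 g22 : ℝ × ℝ × ℝ → ℝ) (q : ℝ × ℝ × ℝ) : ℝ :=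
  (-(g12 q) * (2 * pdx2 g12 q - pdx1 g22 q) + g11 q * pdx2 g22 q) / (2 * detg g11 g12 g22 q)

/-- Gauss curvature of `g` via the Brioschi formula (spatial derivatives). -/
noncomputable def brioschi (g11 g12 g22 : ℝ × ℝ × ℝ → ℝ) (q : ℝ × ℝ × ℝ) : ℝ :=
  (1 / (2 * (detg g11 g12 g22 q) ^ 2)) *
    Matrix.det !![-(pdx2 (pdx2 g11) q) + 2 * pdx1 (pdx2 g12) q - pdx1 (pdx1 g22) q,
                    pdx1 g11 q, 2 * pdx1 g12 q - pdx2 g11 q;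
                  2 * pdx2 g12 q - pdx1 g22 q, 2 * g11 q, 2 * g12 q;
                  pdx2 g22 q, 2 * g12 q, 2 * g22 q]
  - (1 / (2 * (detg g11 g12 g22 q) ^ 2)) *
    Matrix.det !![0, pdx2 g11 q, pdx1 g22 q;
                  pdx2 g11 q, 2 * g11 q, 2 * g12 q;
                  pdx1 g22 q, 2 * g12 q, 2 * g22 q]

/-- The Gauss–Codazzi equations for `(L, M, N)` and the metric `g` at the point `q`. -/
def GaussCodazzi (L M N g11 g12 g22 : ℝ × ℝ × ℝ → ℝ) (q : ℝ × ℝ × ℝ) : Prop :=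
  pdx1 N q - pdx2 M q =
    -(Gamma1_22 g11 g12 g22 q) * L q + 2 * Gamma1_12 g11 g12 g22 q * M q
      - Gamma1_11 g11 g12 g22 q * N q ∧
  pdx1 M q - pdx2 L q =
    Gamma2_22 g11 g12 g22 q * L q - 2 * Gamma2_12 g11 g12 g22 q * M q
      + Gamma2_11 g11 g12 g22 q * N q ∧
  L q * N q - (M q) ^ 2 = brioschi g11 g12 g22 q


abbrev PSIdx := ℕ × ℕ × ℕ
/-- weighted power series: coefficients in the basis `C(j+k,j) s^j r^k t^l`. -/
abbrev PS := lp (fun _ : PSIdx => ℝ) 1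

namespace PS

theorem summable_norm (a : PS) : Summable fun i => ‖a i‖ := by
  have := (memℓp_gen_iff (p := 1) (by simp)).1 (lp.memℓp a)
  simpa using this

theorem norm_eq (a : PS) : ‖a‖ = ∑' i, ‖a i‖ := by
  have := lp.norm_eq_tsum_rpow (p := 1) (by simp) a
  simpa using this

noncomputable def e (i : PSIdx) : PS := lp.single 1 i (1 : ℝ)

theorem norm_e (i : PSIdx) : ‖e i‖ = 1 := by
  unfold e
  rw [lp.norm_single (by simp)]
  simp

theorem hasSum_e (a : PS) : HasSum (fun i => a i • e i) a := by
  have := lp.hasSum_single (p := 1) (by simp) a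
  convert this using 2 with i
  unfold e
  rw [← lp.single_smul]
  simp

variable {X : Type*} [NormedAddCommGroup X] [NormedSpace ℝ X]

theorem ext_e {S T : PS →L[ℝ] X} (h : ∀ i, S (e i) = T (e i)) : S = T := by
  ext1 a
  have h1 := (hasSum_e a).mapL S
  have h2 := (hasSum_e a).mapL T
  simp only [map_smul, h] at h1 h2
  exact h1.unique h2

section lift

theorem summable_lift (x : PSIdx → X) (C : ℝ) (hx : ∀ i, ‖x i‖ ≤ C) (a : PS) :
    Summable fun i => ‖a i • x i‖ := by
  refine Summable.of_nonneg_of_le (fun _ => norm_nonneg _) (fun i => ?_)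
    ((summable_norm a).mul_right C)
  rw [norm_smul]
  exact mul_le_mul_of_nonneg_left (hx i) (norm_nonneg _)

variable [CompleteSpace X]

noncomputable def lift (x : PSIdx → X) (C : ℝ) (hx : ∀ i, ‖x i‖ ≤ C) : PS →L[ℝ] X :=
  LinearMap.mkContinuous
    { toFun := fun a => ∑' i, a i • x i
      map_add' := fun a b => by
        rw [← Summable.tsum_add (summable_lift x C hx a).of_norm (summable_lift x C hx b).of_norm]
        simp [add_smul]
      map_smul' := fun c a => by
        simp only [RingHom.id_apply]
        rw [← Summable.tsum_const_smul c (summable_lift x C hx a).of_norm]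
        simp [mul_smul] } C
    (fun a => by
      refine (norm_tsum_le_tsum_norm (summable_lift x C hx a)).trans ?_
      rw [norm_eq, mul_comm, ← tsum_mul_right]
      refine Summable.tsum_le_tsum (fun i => ?_) (summable_lift x C hx a)
        ((summable_norm a).mul_right C)
      rw [norm_smul]
      exact mul_le_mul_of_nonneg_left (hx i) (norm_nonneg _))

theorem lift_apply (x : PSIdx → X) (C : ℝ) (hx : ∀ i, ‖x i‖ ≤ C) (a : PS) :
    lift x C hx a = ∑' i, a i • x i := rfl

theorem lift_e (x : PSIdx → X) (C : ℝ) (hx : ∀ i, ‖x i‖ ≤ C) (i : PSIdx) :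
    lift x C hx (e i) = x i := by
  rw [lift_apply, tsum_eq_single i]
  · simp [e]
  · intro j hj
    have : e i j = 0 := lp.single_apply_ne _ _ _ hj
    rw [this, zero_smul]

theorem norm_lift_le (x : PSIdx → X) (C : ℝ) (hC : 0 ≤ C) (hx : ∀ i, ‖x i‖ ≤ C) :
    ‖lift x C hx‖ ≤ C :=
  LinearMap.mkContinuous_norm_le _ hC _

end lift

/-- binomial weight -/
def bw (i : PSIdx) : ℝ := ((i.1 + i.2.1).choose i.1 : ℕ)

theorem bw_pos (i : PSIdx) : 0 < bw i := by
  unfold bw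
  exact_mod_cast Nat.choose_pos (Nat.le_add_right _ _)

theorem bw_mul_le (i j : PSIdx) : bw i * bw j ≤ bw (i + j) := by
  unfold bw
  have h : (i.1 + i.2.1).choose i.1 * (j.1 + j.2.1).choose j.1 ≤
      ((i + j).1 + (i + j).2.1).choose (i + j).1 := by
    have := Nat.add_choose_eq (i.1 + i.2.1) (j.1 + j.2.1) (i.1 + j.1)
    simp only [Prod.fst_add, Prod.snd_add]
    rw [show i.1 + j.1 + (i.2.1 + j.2.1) = i.1 + i.2.1 + (j.1 + j.2.1) by ring, this]
    exact Finset.single_le_sum (f := fun ij : ℕ × ℕ => (i.1 + i.2.1).choose ij.1 * (j.1 + j.2.1).choose ij.2)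
      (fun _ _ => Nat.zero_le _) (show (i.1, j.1) ∈ _ by simp)
  exact_mod_cast h

theorem norm_mul_aux (i j : PSIdx) : ‖(bw i * bw j / bw (i + j)) • e (i + j)‖ ≤ 1 := by
  rw [norm_smul, norm_e, mul_one, Real.norm_eq_abs, abs_of_nonneg
    (div_nonneg (mul_pos (bw_pos i) (bw_pos j)).le (bw_pos _).le)]
  exact (div_le_one (bw_pos _)).2 (bw_mul_le i j)

/-- multiplication -/
noncomputable def mul : PS →L[ℝ] PS →L[ℝ] PS :=
  lift (fun i => lift (fun j => (bw i * bw j / bw (i + j)) • e (i + j)) 1 (norm_mul_aux i)) 1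
    (fun _ => norm_lift_le _ _ zero_le_one _)

theorem mul_e (i j : PSIdx) : mul (e i) (e j) = (bw i * bw j / bw (i + j)) • e (i + j) := by
  unfold mul; rw [lift_e, lift_e]

theorem norm_mul_le (a b : PS) : ‖mul a b‖ ≤ ‖a‖ * ‖b‖ := by
  have h : ‖mul‖ ≤ 1 := norm_lift_le _ _ zero_le_one _
  calc ‖mul a b‖ ≤ ‖mul‖ * ‖a‖ * ‖b‖ := mul.le_opNorm₂ a b
    _ ≤ 1 * ‖a‖ * ‖b‖ := by gcongr
    _ = _ := by ring

noncomputable def one : PS := e 0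

theorem one_mul (a : PS) : mul one a = a := by
  have : mul one = ContinuousLinearMap.id ℝ PS := by
    apply ext_e
    intro i
    rw [one, mul_e]
    have h0 : bw 0 = 1 := by simp [bw]
    simp [h0, (bw_pos i).ne']
  rw [this]; rfl

theorem mul_one (a : PS) : mul a one = a := by
  have : mul.flip one = ContinuousLinearMap.id ℝ PS := by
    apply ext_e
    intro i
    rw [ContinuousLinearMap.flip_apply, one, mul_e]
    have h0 : bw 0 = 1 := by simp [bw]
    simp [h0, (bw_pos i).ne']
  rw [← ContinuousLinearMap.flip_apply, this]; rfl

/-- integration in `s` -/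
noncomputable def J : PS →L[ℝ] PS :=
  lift (fun i => ((1 : ℝ) / (i.1 + i.2.1 + 1)) • e (i.1 + 1, i.2)) 1 (fun i => by
    rw [norm_smul, norm_e, _root_.mul_one, Real.norm_eq_abs, abs_of_nonneg (by positivity)]
    rw [div_le_one (by positivity)]
    have : (0:ℝ) ≤ i.1 + i.2.1 := by positivity
    linarith)

/-- the operator `∂_r J` -/
noncomputable def K : PS →L[ℝ] PS :=
  lift (fun i => if i.2.1 = 0 then 0 else e (i.1 + 1, i.2.1 - 1, i.2.2)) 1 (fun i => by
    split_ifs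
    · simp
    · rw [norm_e])

theorem J_e (i : PSIdx) : J (e i) = ((1 : ℝ) / (i.1 + i.2.1 + 1)) • e (i.1 + 1, i.2) := by
  unfold J; rw [lift_e]

theorem K_e (i : PSIdx) :
    K (e i) = if i.2.1 = 0 then 0 else e (i.1 + 1, i.2.1 - 1, i.2.2) := by
  unfold K; rw [lift_e]

/-- domain of evaluation -/
def Om : Set (ℝ × ℝ × ℝ) := {q | |q.1| < 1 / 2 ∧ |q.2.1| < 1 / 2 ∧ |q.2.2| < 1 / 2}

def mon (q : ℝ × ℝ × ℝ) (i : PSIdx) : ℝ := bw i * (q.1 ^ i.1 * q.2.1 ^ i.2.1 * q.2.2 ^ i.2.2)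

theorem bw_le (i : PSIdx) : bw i ≤ 2 ^ (i.1 + i.2.1) := by
  unfold bw
  exact_mod_cast Nat.choose_le_two_pow _ _

theorem norm_mon_le {q : ℝ × ℝ × ℝ} (hq : q ∈ Om) (i : PSIdx) : ‖mon q i‖ ≤ 1 := by
  obtain ⟨h1, h2, h3⟩ := hq
  unfold mon
  rw [Real.norm_eq_abs, abs_mul, abs_mul, abs_mul, abs_pow, abs_pow, abs_pow, abs_of_pos (bw_pos i)]
  calc bw i * (|q.1| ^ i.1 * |q.2.1| ^ i.2.1 * |q.2.2| ^ i.2.2)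
      ≤ 2 ^ (i.1 + i.2.1) * ((1/2) ^ i.1 * (1/2) ^ i.2.1 * 1 ^ i.2.2) := by
        gcongr
        · exact bw_le i
        · linarith
    _ = 1 := by
        rw [pow_add, one_pow, _root_.mul_one, mul_mul_mul_comm, ← mul_pow, ← mul_pow]; norm_num

open Classical in
/-- evaluation at a point -/
noncomputable def ev (q : ℝ × ℝ × ℝ) : PS →L[ℝ] ℝ :=
  if hq : q ∈ Om then lift (mon q) 1 (norm_mon_le hq) else 0

theorem ev_e {q : ℝ × ℝ × ℝ} (hq : q ∈ Om) (i : PSIdx) : ev q (e i) = mon q i := by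
  unfold ev; rw [dif_pos hq, lift_e]

theorem ev_mul {q : ℝ × ℝ × ℝ} (hq : q ∈ Om) (a b : PS) : ev q (mul a b) = ev q a * ev q b := by
  have : (ContinuousLinearMap.compL ℝ PS PS ℝ (ev q)).comp mul =
      ((ContinuousLinearMap.mul ℝ ℝ).bilinearComp (ev q) (ev q)) := by
    apply ext_e
    intro i
    apply ext_e
    intro j
    simp only [ContinuousLinearMap.comp_apply, ContinuousLinearMap.compL_apply,
      ContinuousLinearMap.bilinearComp_apply, ContinuousLinearMap.mul_apply', mul_e, map_smul,
      ev_e hq, smul_eq_mul]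
    have := (bw_pos (i + j)).ne'
    simp only [mon, Prod.fst_add, Prod.snd_add]
    field_simp
    ring
  exact congrArg (fun T => T a b) this

theorem ev_one {q : ℝ × ℝ × ℝ} (hq : q ∈ Om) : ev q one = 1 := by
  rw [one, ev_e hq]; simp [mon, bw]

theorem bw_succ (j k l : ℕ) : bw (j + 1, k, l) * (j + 1) = bw (j, k, l) * (j + k + 1) := by
  unfold bw
  have := Nat.add_one_mul_choose_eq (j + k) j
  have h2 : (j + 1 + k).choose (j + 1) * (j + 1) = (j + k).choose j * (j + k + 1) := by
    rw [show j + 1 + k = j + k + 1 by ring, ← this]; ring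
  exact_mod_cast h2

theorem bw_succ' (j k l : ℕ) : bw (j, k + 1, l) * (k + 1) = bw (j, k, l) * (j + k + 1) := by
  unfold bw
  have := Nat.choose_mul_succ_eq (j + k) j
  have h2 : (j + (k + 1)).choose j * (k + 1) = (j + k).choose j * (j + k + 1) := by
    rw [this, show j + (k + 1) = j + k + 1 by ring, show j + k + 1 - j = k + 1 by omega]
  exact_mod_cast h2

theorem ev_Je {q : ℝ × ℝ × ℝ} (hq : q ∈ Om) (i : PSIdx) :
    ev q (J (e i)) = 1 / (i.1 + i.2.1 + 1) * mon q (i.1 + 1, i.2) := by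
  rw [J_e, map_smul, ev_e hq, smul_eq_mul]

theorem hasDerivAt_mon_s (i : PSIdx) (s r t : ℝ) :
    HasDerivAt (fun s => 1 / ((i.1 : ℝ) + i.2.1 + 1) * mon (s, r, t) (i.1 + 1, i.2))
      (mon (s, r, t) i) s := by
  obtain ⟨j, k, l⟩ := i
  have h := ((hasDerivAt_pow (j + 1) s).mul_const (r ^ k)).mul_const (t ^ l)
  have h2 := (h.const_mul (bw (j + 1, k, l))).const_mul (1 / ((j : ℝ) + k + 1))
  refine h2.congr_deriv ?_
  have e := bw_succ j k l
  simp only [mon, Nat.add_sub_cancel, Nat.cast_add, Nat.cast_one]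
  have : (j : ℝ) + k + 1 ≠ 0 := by positivity
  field_simp
  linear_combination (s ^ j * r ^ k * t ^ l) * e

theorem hasDerivAt_mon_r (i : PSIdx) (s r t : ℝ) :
    HasDerivAt (fun r => 1 / ((i.1 : ℝ) + i.2.1 + 1) * mon (s, r, t) (i.1 + 1, i.2))
      (if i.2.1 = 0 then 0 else mon (s, r, t) (i.1 + 1, i.2.1 - 1, i.2.2)) r := by
  obtain ⟨j, k, l⟩ := i
  have h := ((hasDerivAt_pow k r).const_mul (s ^ (j + 1))).mul_const (t ^ l)
  have h2 := (h.const_mul (bw (j + 1, k, l))).const_mul (1 / ((j : ℝ) + k + 1))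
  refine h2.congr_deriv ?_
  rcases k with _ | k
  · simp
  · have e := bw_succ' (j + 1) k l
    simp only [mon, Nat.add_sub_cancel, Nat.cast_add, Nat.cast_one] at e ⊢
    have : (j : ℝ) + (k + 1) + 1 ≠ 0 := by positivity
    rw [if_neg (by omega)]
    field_simp
    linear_combination (s ^ (j+1) * r ^ k * t ^ l) * e

theorem ev_apply {q : ℝ × ℝ × ℝ} (a : PS) : ev q a = ∑' i, a i * ev q (e i) := by
  have h1 := (hasSum_e a).mapL (ev q)
  simp only [map_smul, smul_eq_mul] at h1
  exact h1.tsum_eq.symm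

theorem ev_comp_apply {q : ℝ × ℝ × ℝ} (T : PS →L[ℝ] PS) (a : PS) :
    HasSum (fun i => a i * ev q (T (e i))) (ev q (T a)) := by
  have h1 := (hasSum_e a).mapL ((ev q).comp T)
  simpa only [map_smul, smul_eq_mul, ContinuousLinearMap.comp_apply] using h1

theorem ev_K_e {q : ℝ × ℝ × ℝ} (hq : q ∈ Om) (i : PSIdx) : ev q (K (e i)) =
   (if i.2.1 = 0 then 0 else mon q (i.1 + 1, i.2.1 - 1, i.2.2)) := by
  rw [K_e]; split_ifs
  · simp
  · rw [ev_e hq]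

theorem hasDerivAt_ev_J_s {s r t : ℝ} (hq : (s, r, t) ∈ Om) (a : PS) :
    HasDerivAt (fun s => ev (s, r, t) (J a)) (ev (s, r, t) a) s := by
  have hm : ∀ y ∈ Set.Ioo (-(1/2) : ℝ) (1/2), (y, r, t) ∈ Om := fun y hy =>
    ⟨abs_lt.2 hy, hq.2⟩
  have hs : s ∈ Set.Ioo (-(1/2) : ℝ) (1/2) := abs_lt.1 hq.1
  have key := hasDerivAt_tsum_of_isPreconnected (t := Set.Ioo (-(1/2) : ℝ) (1/2))
    (u := fun i => ‖a i‖)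
    (g := fun i s => a i * (1 / ((i.1 : ℝ) + i.2.1 + 1) * mon (s, r, t) (i.1 + 1, i.2)))
    (g' := fun i s => a i * mon (s, r, t) i) (y₀ := s) (y := s)
    (summable_norm a) isOpen_Ioo isPreconnected_Ioo
    (fun i y _ => (hasDerivAt_mon_s i y r t).const_mul _)
    (fun i y hy => by
      rw [norm_mul]
      exact mul_le_of_le_one_right (norm_nonneg _) (norm_mon_le (hm y hy) i)) hs
    (by
      have := (ev_comp_apply (q := (s, r, t)) J a).summable
      simpa only [ev_Je hq] using this) hs
  have e1 : ev (s, r, t) a = ∑' i, a i * mon (s, r, t) i := by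
    rw [ev_apply]; simp only [ev_e hq]
  rw [e1]
  refine key.congr_of_eventuallyEq ?_
  filter_upwards [isOpen_Ioo.mem_nhds hs] with y hy
  have := (ev_comp_apply (q := (y, r, t)) J a).tsum_eq
  simp only [ev_Je (hm y hy)] at this
  exact this.symm

theorem hasDerivAt_ev_J_r {s r t : ℝ} (hq : (s, r, t) ∈ Om) (a : PS) :
    HasDerivAt (fun r => ev (s, r, t) (J a)) (ev (s, r, t) (K a)) r := by
  have hm : ∀ y ∈ Set.Ioo (-(1/2) : ℝ) (1/2), (s, y, t) ∈ Om := fun y hy =>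
    ⟨hq.1, abs_lt.2 hy, hq.2.2⟩
  have hs : r ∈ Set.Ioo (-(1/2) : ℝ) (1/2) := abs_lt.1 hq.2.1
  have key := hasDerivAt_tsum_of_isPreconnected (t := Set.Ioo (-(1/2) : ℝ) (1/2))
    (u := fun i => ‖a i‖)
    (g := fun i r => a i * (1 / ((i.1 : ℝ) + i.2.1 + 1) * mon (s, r, t) (i.1 + 1, i.2)))
    (g' := fun i r => a i * (if i.2.1 = 0 then 0 else mon (s, r, t) (i.1 + 1, i.2.1 - 1, i.2.2)))
    (y₀ := r) (y := r)
    (summable_norm a) isOpen_Ioo isPreconnected_Ioo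
    (fun i y _ => (hasDerivAt_mon_r i s y t).const_mul _)
    (fun i y hy => by
      rw [norm_mul]
      refine mul_le_of_le_one_right (norm_nonneg _) ?_
      split_ifs
      · simp
      · exact norm_mon_le (hm y hy) _) hs
    (by
      have := (ev_comp_apply (q := (s, r, t)) J a).summable
      simpa only [ev_Je hq] using this) hs
  have e1 : ev (s, r, t) (K a) =
      ∑' i, a i * (if i.2.1 = 0 then 0 else mon (s, r, t) (i.1 + 1, i.2.1 - 1, i.2.2)) := by
    rw [← (ev_comp_apply (q := (s, r, t)) K a).tsum_eq]; simp only [ev_K_e hq]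
  rw [e1]
  refine key.congr_of_eventuallyEq ?_
  filter_upwards [isOpen_Ioo.mem_nhds hs] with y hy
  have := (ev_comp_apply (q := (s, y, t)) J a).tsum_eq
  simp only [ev_Je (hm y hy)] at this
  exact this.symm

end PS

namespace PS

noncomputable def B1 : PS →L[ℝ] PS :=
  lift (fun i => if i.1 = 0 then 0 else e (i.1 - 1, i.2)) 1 (fun i => by
    split_ifs
    · simp
    · rw [norm_e])

noncomputable def B2 : PS →L[ℝ] PS :=
  lift (fun i => if i.2.1 = 0 then 0 else e (i.1, i.2.1 - 1, i.2.2)) 1 (fun i => by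
    split_ifs
    · simp
    · rw [norm_e])

noncomputable def B3 : PS →L[ℝ] PS :=
  lift (fun i => if i.2.2 = 0 then 0 else e (i.1, i.2.1, i.2.2 - 1)) 1 (fun i => by
    split_ifs
    · simp
    · rw [norm_e])

noncomputable def c0 : PS →L[ℝ] ℝ :=
  lift (fun i => if i = 0 then 1 else 0) 1 (fun i => by
    split_ifs <;> simp)

theorem norm_B1 : ‖B1‖ ≤ 1 := norm_lift_le _ _ zero_le_one _
theorem norm_B2 : ‖B2‖ ≤ 1 := norm_lift_le _ _ zero_le_one _
theorem norm_B3 : ‖B3‖ ≤ 1 := norm_lift_le _ _ zero_le_one _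

theorem B1_e (j k l : ℕ) : B1 (e (j, k, l)) = if j = 0 then 0 else e (j - 1, k, l) := by
  unfold B1; rw [lift_e]
theorem B2_e (j k l : ℕ) : B2 (e (j, k, l)) = if k = 0 then 0 else e (j, k - 1, l) := by
  unfold B2; rw [lift_e]
theorem B3_e (j k l : ℕ) : B3 (e (j, k, l)) = if l = 0 then 0 else e (j, k, l - 1) := by
  unfold B3; rw [lift_e]
theorem c0_e (i : PSIdx) : c0 (e i) = if i = 0 then 1 else 0 := by
  unfold c0; rw [lift_e]

noncomputable def P12 (q : ℝ × ℝ × ℝ) : PS →L[ℝ] PS := 1 - (q.1 • B1 + q.2.1 • B2)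
noncomputable def P3 (q : ℝ × ℝ × ℝ) : PS →L[ℝ] PS := 1 - q.2.2 • B3

theorem bw_pascal (j k l : ℕ) :
    bw (j + 1, k + 1, l) = bw (j, k + 1, l) + bw (j + 1, k, l) := by
  unfold bw
  have := Nat.choose_succ_succ (j + k + 1) j
  simp only
  rw [show j + 1 + (k + 1) = (j + k + 1).succ by omega, show j + (k + 1) = j + k + 1 by omega,
    show j + 1 + k = j + k + 1 by omega]
  exact_mod_cast this

theorem ev_P12 {q : ℝ × ℝ × ℝ} (hq : q ∈ Om) (j k l : ℕ) :
    ev q (P12 q (e (j, k, l))) = if j = 0 ∧ k = 0 then q.2.2 ^ l else 0 := by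
  simp only [P12, sub_apply, one_apply_eq_self,
    add_apply, smul_apply, B1_e, B2_e, map_sub, map_add,
    map_smul, ev_e hq]
  rcases j with _ | j <;> rcases k with _ | k
  · simp [mon, bw]
  · simp [mon, bw, ev_e hq, pow_succ]; ring
  · simp [mon, bw, ev_e hq, pow_succ]; ring
  · simp only [mon, Nat.add_eq_zero_iff, one_ne_zero, and_false, if_false, ev_e hq, bw_pascal,
      Nat.add_sub_cancel, smul_eq_mul]
    ring

theorem ev_P {q : ℝ × ℝ × ℝ} (hq : q ∈ Om) : ((ev q).comp (P12 q)).comp (P3 q) = c0 := by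
  apply ext_e
  rintro ⟨j, k, l⟩
  simp only [ContinuousLinearMap.comp_apply, c0_e]
  simp only [P3, sub_apply, one_apply_eq_self,
    smul_apply, B3_e, map_sub, map_smul, ev_P12 hq]
  rcases l with _ | l
  · simp [Prod.ext_iff]
  · simp only [Nat.add_eq_zero_iff, one_ne_zero, and_false, if_false, ev_P12 hq,
      Nat.add_sub_cancel, smul_eq_mul, Prod.ext_iff]
    split_ifs <;> simp_all [pow_succ]
    ring

theorem norm12 {q : ℝ × ℝ × ℝ} (hq : q ∈ Om) : ‖q.1 • B1 + q.2.1 • B2‖ < 1 := by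
  calc _ ≤ ‖q.1 • B1‖ + ‖q.2.1 • B2‖ := norm_add_le _ _
    _ ≤ |q.1| * 1 + |q.2.1| * 1 := by
      rw [norm_smul, norm_smul, Real.norm_eq_abs, Real.norm_eq_abs]
      gcongr
      · exact norm_B1
      · exact norm_B2
    _ < 1 := by have := hq.1; have := hq.2.1; linarith

theorem norm3 {q : ℝ × ℝ × ℝ} (hq : q ∈ Om) : ‖q.2.2 • B3‖ < 1 := by
  calc _ ≤ |q.2.2| * 1 := by
        rw [norm_smul, Real.norm_eq_abs]
        gcongr
        exact norm_B3
    _ < 1 := by have := hq.2.2; linarith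

theorem ev_eq {q : ℝ × ℝ × ℝ} (hq : q ∈ Om) (a : PS) :
    ev q a = c0 (Ring.inverse (P3 q) (Ring.inverse (P12 q) a)) := by
  have u12 : IsUnit (P12 q) := isUnit_one_sub_of_norm_lt_one (norm12 hq)
  have u3 : IsUnit (P3 q) := isUnit_one_sub_of_norm_lt_one (norm3 hq)
  rw [← ev_P hq]
  have h3 : ∀ x, P3 q (Ring.inverse (P3 q) x) = x := fun x => by
    rw [← mul_apply_eq_comp, Ring.mul_inverse_cancel _ u3]; rfl
  have h12 : ∀ x, P12 q (Ring.inverse (P12 q) x) = x := fun x => by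
    rw [← mul_apply_eq_comp, Ring.mul_inverse_cancel _ u12]; rfl
  simp only [ContinuousLinearMap.comp_apply, h3, h12]

theorem isOpen_Om : IsOpen Om := by
  unfold Om
  refine IsOpen.and ?_ (IsOpen.and ?_ ?_) <;> exact isOpen_lt (by fun_prop) (by fun_prop)

theorem analytic_ev (a : PS) : AnalyticOnNhd ℝ (fun q => ev q a) Om := by
  intro q hq
  have u12 : IsUnit (P12 q) := isUnit_one_sub_of_norm_lt_one (norm12 hq)
  have u3 : IsUnit (P3 q) := isUnit_one_sub_of_norm_lt_one (norm3 hq)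
  have a1 : AnalyticAt ℝ (fun q : ℝ × ℝ × ℝ => q.1) q := analyticAt_fst
  have a2 : AnalyticAt ℝ (fun q : ℝ × ℝ × ℝ => q.2.1) q :=
    analyticAt_fst.comp analyticAt_snd
  have a3 : AnalyticAt ℝ (fun q : ℝ × ℝ × ℝ => q.2.2) q :=
    analyticAt_snd.comp analyticAt_snd
  have p12 : AnalyticAt ℝ P12 q :=
    analyticAt_const.sub ((a1.smul analyticAt_const).add (a2.smul analyticAt_const))
  have p3 : AnalyticAt ℝ P3 q := analyticAt_const.sub (a3.smul analyticAt_const)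
  have i12 : AnalyticAt ℝ (fun q => Ring.inverse (P12 q)) q :=
    AnalyticAt.comp (g := Ring.inverse) (f := P12) (by
      have := analyticAt_inverse (𝕜 := ℝ) u12.unit
      simpa using this) p12
  have i3 : AnalyticAt ℝ (fun q => Ring.inverse (P3 q)) q :=
    AnalyticAt.comp (g := Ring.inverse) (f := P3) (by
      have := analyticAt_inverse (𝕜 := ℝ) u3.unit
      simpa using this) p3
  have h2 : AnalyticAt ℝ (fun q => (Ring.inverse (P3 q) * Ring.inverse (P12 q)) a) q :=
    ((ContinuousLinearMap.apply ℝ PS a).analyticAt _).comp (i3.mul i12)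
  have h3 := (c0.analyticAt _).comp h2
  refine h3.congr ?_
  filter_upwards [isOpen_Om.mem_nhds hq] with x hx
  exact (ev_eq hx a).symm

/-- product of variables along a word, first variable scaled by `d`. -/
noncomputable def X (d : ℝ) : Fin 3 → PS := ![d • e (1, 0, 0), e (0, 1, 0), e (0, 0, 1)]

noncomputable def word (d : ℝ) : List (Fin 3) → PS
  | [] => one
  | i :: l => mul (X d i) (word d l)

def vec (d : ℝ) (q : ℝ × ℝ × ℝ) : Fin 3 → ℝ := ![d * q.1, q.2.1, q.2.2]

theorem norm_X {d : ℝ} (hd : |d| ≤ 1) (i : Fin 3) : ‖X d i‖ ≤ 1 := by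
  fin_cases i <;> simp [X, norm_e, norm_smul, hd]

theorem ev_X (d : ℝ) {q : ℝ × ℝ × ℝ} (hq : q ∈ Om) (i : Fin 3) : ev q (X d i) = vec d q i := by
  fin_cases i <;> simp [X, vec, ev_e hq, mon, bw]

theorem norm_word {d : ℝ} (hd : |d| ≤ 1) (l : List (Fin 3)) : ‖word d l‖ ≤ 1 := by
  induction l with
  | nil => simp [word, one, norm_e]
  | cons i l ih =>
    exact (norm_mul_le _ _).trans (mul_le_one₀ (norm_X hd i) (norm_nonneg _) ih)

theorem ev_word (d : ℝ) {q : ℝ × ℝ × ℝ} (hq : q ∈ Om) (l : List (Fin 3)) :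
    ev q (word d l) = (l.map (vec d q)).prod := by
  induction l with
  | nil => simp [word, ev_one hq]
  | cons i l ih => simp [word, ev_mul hq, ev_X d hq, ih]

def bas : Fin 3 → ℝ × ℝ × ℝ := ![(1, 0, 0), (0, 1, 0), (0, 0, 1)]

theorem norm_bas (i : Fin 3) : ‖bas i‖ = 1 := by
  fin_cases i <;> simp [bas, Prod.norm_def]

theorem sum_bas (d : ℝ) (q : ℝ × ℝ × ℝ) : ∑ i, vec d q i • bas i = (d * q.1, q.2.1, q.2.2) := by
  simp [Fin.sum_univ_three, vec, bas]

set_option maxHeartbeats 1000000 in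
theorem repr_exists {f : ℝ × ℝ × ℝ → ℝ} (hf : AnalyticAt ℝ f 0) {η : ℝ} (hη : 0 < η) :
    ∃ d₀ > 0, ∀ d, 0 < d → d < d₀ → ∃ a : PS, ‖a - f 0 • one‖ < η ∧
      ∀ q ∈ Om, ev q a = f (d ^ 2 * q.1, d * q.2.1, d * q.2.2) := by
  obtain ⟨p, R, hp⟩ := hf
  obtain ⟨ρ, hρ0, hρ⟩ := ENNReal.lt_iff_exists_nnreal_btwn.1 hp.r_pos
  have hρpos : (0 : ℝ) < ρ := by exact_mod_cast hρ0
  have hsum : Summable fun n => ‖p n‖ * (ρ : ℝ) ^ n :=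
    p.summable_norm_mul_pow (hρ.trans_le hp.r_le)
  set S := ∑' n, ‖p n‖ * (ρ : ℝ) ^ n with hS
  have hS0 : 0 ≤ S := tsum_nonneg fun n => by positivity
  refine ⟨min (min 1 (ρ / 3)) (η * ρ / (3 * (S + 1))), by positivity, ?_⟩
  intro d hd hdd
  have hd1 : d < 1 := hdd.trans_le ((min_le_left _ _).trans (min_le_left _ _))
  have hd2 : 3 * d ≤ ρ := by
    have := hdd.trans_le ((min_le_left _ _).trans (min_le_right _ _)); linarith
  have hd3 : d < η * ρ / (3 * (S + 1)) := hdd.trans_le (min_le_right _ _)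
  have hdabs : |d| ≤ 1 := by rw [abs_of_pos hd]; exact hd1.le
  let T : ℕ → PS := fun n => d ^ n • ∑ w : Fin n → Fin 3, p n (fun i => bas (w i)) •
    word d (List.ofFn w)
  have hpn : ∀ n (w : Fin n → Fin 3), ‖p n (fun i => bas (w i))‖ ≤ ‖p n‖ := by
    intro n w
    have := (p n).le_opNorm (fun i => bas (w i))
    simpa [norm_bas] using this
  have hT : ∀ n, ‖T n‖ ≤ ‖p n‖ * (3 * d) ^ n := by
    intro n
    simp only [T]
    rw [norm_smul, norm_pow, Real.norm_eq_abs, abs_of_pos hd]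
    have : ‖∑ w : Fin n → Fin 3, p n (fun i => bas (w i)) • word d (List.ofFn w)‖ ≤
        ∑ w : Fin n → Fin 3, ‖p n‖ := by
      refine norm_sum_le_of_le _ fun w _ => ?_
      rw [norm_smul]
      exact (mul_le_of_le_one_right (norm_nonneg _) (norm_word hdabs _)).trans (hpn n w)
    have h3 : ∑ w : Fin n → Fin 3, ‖p n‖ = 3 ^ n * ‖p n‖ := by simp
    rw [h3] at this
    calc _ ≤ d ^ n * (3 ^ n * ‖p n‖) := by gcongr
      _ = _ := by rw [mul_pow]; ring
  have hTs : Summable fun n => ‖T n‖ := by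
    refine Summable.of_nonneg_of_le (fun _ => norm_nonneg _) (fun n => (hT n).trans ?_) hsum
    gcongr
  have hT0 : T 0 = f 0 • one := by
    have h0 : p 0 (fun i => bas (Fin.elim0 i)) = f 0 := hp.coeff_zero _
    simp only [T, pow_zero, one_smul]
    rw [Fintype.sum_unique]
    simp only [List.ofFn_zero, word]
    congr 1
  refine ⟨∑' n, T n, ?_, ?_⟩
  · rw [hTs.of_norm.tsum_eq_zero_add, hT0, add_sub_cancel_left]
    have hTs' : Summable fun n => ‖T (n + 1)‖ := (summable_nat_add_iff 1).2 hTs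
    refine (norm_tsum_le_tsum_norm hTs').trans_lt ?_
    have hb : ∀ n, ‖T (n + 1)‖ ≤ (3 * d / ρ) * (‖p (n + 1)‖ * (ρ : ℝ) ^ (n + 1)) := by
      intro n
      refine (hT (n + 1)).trans ?_
      have : (3 * d) ^ (n + 1) ≤ (3 * d / ρ) * (ρ : ℝ) ^ (n + 1) := by
        rw [pow_succ, pow_succ]
        have h : (3 * d) ^ n ≤ (ρ : ℝ) ^ n := by gcongr
        calc (3 * d) ^ n * (3 * d) ≤ (ρ : ℝ) ^ n * (3 * d) := by gcongr
          _ = _ := by field_simp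
      calc _ ≤ ‖p (n + 1)‖ * ((3 * d / ρ) * (ρ : ℝ) ^ (n + 1)) := by gcongr
        _ = _ := by ring
    have hsum' : Summable fun n => ‖p (n + 1)‖ * (ρ : ℝ) ^ (n + 1) :=
      (summable_nat_add_iff 1).2 hsum
    have hle : ∑' n, ‖p (n + 1)‖ * (ρ : ℝ) ^ (n + 1) ≤ S := by
      rw [hS, hsum.tsum_eq_zero_add]
      have : 0 ≤ ‖p 0‖ * (ρ : ℝ) ^ 0 := by positivity
      linarith
    calc ∑' n, ‖T (n + 1)‖ ≤ ∑' n, (3 * d / ρ) * (‖p (n + 1)‖ * (ρ : ℝ) ^ (n + 1)) :=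
          Summable.tsum_le_tsum hb hTs' (hsum'.mul_left _)
      _ = (3 * d / ρ) * ∑' n, (‖p (n + 1)‖ * (ρ : ℝ) ^ (n + 1)) := tsum_mul_left
      _ ≤ (3 * d / ρ) * (S + 1) := by gcongr; linarith
      _ < η := by
        rw [lt_div_iff₀ (by positivity)] at hd3
        rw [div_mul_eq_mul_div, div_lt_iff₀ hρpos]
        linarith
  · intro q hq
    have hq' : ‖(d ^ 2 * q.1, d * q.2.1, d * q.2.2)‖ < ρ := by
      obtain ⟨h1, h2, h3⟩ := hq
      have hq1 : |d ^ 2 * q.1| < ρ := by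
        rw [abs_mul, abs_of_pos (by positivity)]; nlinarith [abs_nonneg q.1]
      have hq2 : |d * q.2.1| < ρ := by
        rw [abs_mul, abs_of_pos hd]; nlinarith [abs_nonneg q.2.1]
      have hq3 : |d * q.2.2| < ρ := by
        rw [abs_mul, abs_of_pos hd]; nlinarith [abs_nonneg q.2.2]
      simp only [Prod.norm_def, Real.norm_eq_abs]
      exact max_lt hq1 (max_lt hq2 hq3)
    have hs := hp.hasSum (y := (d ^ 2 * q.1, d * q.2.1, d * q.2.2)) (by
      rw [Metric.mem_eball, edist_zero_right]
      refine lt_trans ?_ hρ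
      rw [← ofReal_norm, ← ENNReal.ofReal_coe_nnreal]
      exact (ENNReal.ofReal_lt_ofReal_iff hρpos).2 hq')
    rw [zero_add] at hs
    have hev := hTs.of_norm.hasSum.mapL (ev q)
    suffices hterm : ∀ n, ev q (T n) = p n (fun _ => (d ^ 2 * q.1, d * q.2.1, d * q.2.2)) by
      simp only [hterm] at hev
      exact hev.unique hs
    intro n
    have e1 : (d ^ 2 * q.1, d * q.2.1, d * q.2.2) = d • ∑ i, vec d q i • bas i := by
      rw [sum_bas]
      ext <;> simp [pow_two, mul_assoc]
    rw [e1]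
    have e2 := (p n).map_smul_univ (fun _ => d) (fun _ => ∑ i, vec d q i • bas i)
    rw [e2]
    simp only [Finset.prod_const, Finset.card_univ, Fintype.card_fin]
    have e3 := (p n).map_sum (fun (_ : Fin n) (i : Fin 3) => vec d q i • bas i)
    rw [e3]
    simp only [T, map_smul, map_sum, ev_word d hq, smul_eq_mul]
    congr 1
    refine Finset.sum_congr rfl fun w _ => ?_
    have e4 := (p n).map_smul_univ (fun i => vec d q (w i)) (fun i => bas (w i))
    rw [e4, List.map_ofFn, List.prod_ofFn, smul_eq_mul, mul_comm]
    rfl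

end PS


theorem soft_ift {Λ X Y : Type*} [NormedAddCommGroup Λ] [NormedSpace ℝ Λ] [CompleteSpace Λ]
    [NormedAddCommGroup X] [NormedSpace ℝ X] [CompleteSpace X]
    [NormedAddCommGroup Y] [NormedSpace ℝ Y] [CompleteSpace Y]
    (F : Λ × X → Y) (hF : ContDiff ℝ 1 F) (l₀ : Λ) (V₀ : X) (h0 : F (l₀, V₀) = 0)
    (T : X → Y) (hT : ∀ W, F (l₀, V₀ + W) = T W) (hTl : ∀ (c : ℝ) W, T (c • W) = c • T W)
    (hs : Function.Surjective T) :
    ∃ η > 0, ∀ l, ‖l - l₀‖ < η → ∃ V, F (l, V) = 0 := by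
  have hF' : HasStrictFDerivAt F (fderiv ℝ F (l₀, V₀)) (l₀, V₀) :=
    hF.contDiffAt.hasStrictFDerivAt (by simp)
  have hG := (hasStrictFDerivAt_fst (𝕜 := ℝ) (p := (l₀, V₀))).prodMk hF'
  have hTF : ∀ W, fderiv ℝ F (l₀, V₀) (0, W) = T W := by
    intro W
    have h1 : HasDerivAt (fun c : ℝ => (l₀, V₀ + c • W)) ((0, W) : Λ × X) 0 := by
      have := ((hasDerivAt_id (0 : ℝ)).smul_const W).const_add V₀
      simpa using (hasDerivAt_const (0 : ℝ) l₀).prodMk this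
    have h2 : HasDerivAt (fun c : ℝ => F (l₀, V₀ + c • W)) (fderiv ℝ F (l₀, V₀) (0, W)) 0 := by
      refine HasFDerivAt.comp_hasDerivAt (l := F) (f := fun c : ℝ => (l₀, V₀ + c • W)) 0 ?_ h1
      simpa using hF'.hasFDerivAt
    have h3 : HasDerivAt (fun c : ℝ => F (l₀, V₀ + c • W)) (T W) 0 := by
      simp only [hT, hTl]
      simpa using (hasDerivAt_id (0 : ℝ)).smul_const (T W)
    exact h2.unique h3
  have hmap := hG.map_nhds_eq_of_surj (by
    rw [LinearMap.range_eq_top]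
    rintro ⟨m, y⟩
    obtain ⟨W, hW⟩ := hs (y - fderiv ℝ F (l₀, V₀) (m, 0))
    refine ⟨(m, W), ?_⟩
    have : ((m, W) : Λ × X) = (m, 0) + (0, W) := by simp
    simp only [ContinuousLinearMap.coe_coe, ContinuousLinearMap.prod_apply,
      ContinuousLinearMap.coe_fst', Prod.mk.injEq, true_and]
    rw [this, map_add, hTF, hW]; abel)
  rw [h0] at hmap
  have hr : Set.range (fun p : Λ × X => (p.1, F p)) ∈ nhds (l₀, (0 : Y)) := by
    rw [← hmap, Filter.mem_map]
    exact Filter.univ_mem' fun x => ⟨x, rfl⟩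
  have hc : Filter.Tendsto (fun l : Λ => (l, (0 : Y))) (nhds l₀) (nhds (l₀, 0)) :=
    (Continuous.prodMk continuous_id continuous_const).tendsto _
  obtain ⟨η, hη, hb⟩ := Metric.mem_nhds_iff.1 (hc hr)
  refine ⟨η, hη, fun l hl => ?_⟩
  have := hb (show l ∈ Metric.ball l₀ η by rw [Metric.mem_ball, dist_eq_norm]; exact hl)
  obtain ⟨⟨l', V⟩, h⟩ := this
  simp only [Prod.mk.injEq] at h
  obtain ⟨rfl, h⟩ := h
  exact ⟨V, h⟩

section
variable {A : Type*} [NormedAddCommGroup A] [NormedSpace ℝ A] [CompleteSpace A]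
  (mul : A →L[ℝ] A →L[ℝ] A) (one : A) (J K : A →L[ℝ] A)

/-- the integrated structure + Codazzi equations, depending on `d` and coefficients. -/
structure IsSol (m d : ℝ) (L M N f1 f2 κ al be ga w1 w2 : A) : Prop where
  e1 : mul w1 (one + d ^ 2 • J ga) - (be - (m • al + d • K al)) = 0
  e2 : mul w2 (one + d ^ 2 • J al) - mul w1 (d ^ 2 • J be) - ga = 0
  e3 : mul (one + d ^ 2 • J al) f1 - mul (d ^ 2 • J be) f2
      + mul (m • be + d • K be - mul (one + d ^ 2 • J ga) w2) L
      - (2 : ℝ) • mul (m • al + d • K al) M + mul al N = 0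
  e4 : mul (one + d ^ 2 • J ga) f2 - mul (m • ga + d • K ga + mul (d ^ 2 • J be) w2) L
      + (2 : ℝ) • mul (mul (one + d ^ 2 • J al) w2) M - mul (mul (one + d ^ 2 • J al) w1) N = 0
  e5 : w2 - m • w1 - d • K w1
      + d ^ 2 • J (mul κ (mul (one + d ^ 2 • J al) (one + d ^ 2 • J ga))) = 0

theorem exists_sol (one_mul : ∀ a, mul one a = a) (mul_one : ∀ a, mul a one = a)
    (m L0 M0 N0 f10 f20 κ0 : ℝ) (hχ : N0 - 2 * m * M0 + m ^ 2 * L0 ≠ 0) :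
    ∃ η > 0, ∀ (d : ℝ) (L M N f1 f2 κ : A), |d| < η → ‖L - L0 • one‖ < η → ‖M - M0 • one‖ < η →
      ‖N - N0 • one‖ < η → ‖f1 - f10 • one‖ < η → ‖f2 - f20 • one‖ < η → ‖κ - κ0 • one‖ < η →
      ∃ al be ga w1 w2, IsSol mul one J K m d L M N f1 f2 κ al be ga w1 w2 := by
  let F : (ℝ × A × A × A × A × A × A) × (A × A × A × A × A) → A × A × A × A × A :=
    fun x =>
      let d := x.1.1; let L := x.1.2.1; let M := x.1.2.2.1; let N := x.1.2.2.2.1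
      let f1 := x.1.2.2.2.2.1; let f2 := x.1.2.2.2.2.2.1; let κ := x.1.2.2.2.2.2.2
      let al := x.2.1; let be := x.2.2.1; let ga := x.2.2.2.1; let w1 := x.2.2.2.2.1
      let w2 := x.2.2.2.2.2
      (mul w1 (one + d ^ 2 • J ga) - (be - (m • al + d • K al)),
       mul w2 (one + d ^ 2 • J al) - mul w1 (d ^ 2 • J be) - ga,
       mul (one + d ^ 2 • J al) f1 - mul (d ^ 2 • J be) f2
        + mul (m • be + d • K be - mul (one + d ^ 2 • J ga) w2) L
        - (2 : ℝ) • mul (m • al + d • K al) M + mul al N,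
       mul (one + d ^ 2 • J ga) f2 - mul (m • ga + d • K ga + mul (d ^ 2 • J be) w2) L
        + (2 : ℝ) • mul (mul (one + d ^ 2 • J al) w2) M - mul (mul (one + d ^ 2 • J al) w1) N,
       w2 - m • w1 - d • K w1
        + d ^ 2 • J (mul κ (mul (one + d ^ 2 • J al) (one + d ^ 2 • J ga))))
  have hF : ContDiff ℝ 1 F := by
    simp only [F]
    fun_prop
  set χ := N0 - 2 * m * M0 + m ^ 2 * L0 with hχd
  let T : A × A × A × A × A → A × A × A × A × A := fun W =>
    (W.2.2.2.1 - W.2.1 + m • W.1, W.2.2.2.2 - W.2.2.1,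
      L0 • (m • W.2.1 - W.2.2.2.2) - (2 * m * M0) • W.1 + N0 • W.1,
      - (L0 * m) • W.2.2.1 + (2 * M0) • W.2.2.2.2 - N0 • W.2.2.2.1,
      W.2.2.2.2 - m • W.2.2.2.1)
  -- base solution
  let w := f20 / χ
  let α := - f10 / χ
  let V₀ : A × A × A × A × A :=
    (α • one, (w + m * α) • one, (m * w) • one, w • one, (m * w) • one)
  have hTV : ∀ V, F ((0, L0 • one, M0 • one, N0 • one, f10 • one, f20 • one, κ0 • one), V) =
      T V + (0, 0, f10 • one, f20 • one, 0) := by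
    rintro ⟨al, be, ga, w1, w2⟩
    simp only [F, T, one_mul, mul_one, map_smul, smul_apply, map_add, map_sub, Prod.mk_add_mk]
    simp [one_mul, mul_one]
    refine ⟨?_, ?_, ?_⟩ <;> module
  have hT0 : T V₀ + (0, 0, f10 • one, f20 • one, 0) = 0 := by
    simp only [T, V₀, Prod.mk_add_mk, Prod.mk_eq_zero, w, α]
    refine ⟨?_, ?_, ?_, ?_, ?_⟩ <;> match_scalars <;> field_simp <;> ring
  obtain ⟨η, hη, h⟩ := soft_ift F hF (0, L0 • one, M0 • one, N0 • one, f10 • one, f20 • one,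
    κ0 • one) V₀ (by rw [hTV, hT0]) T
    (fun W => by
      rw [hTV]
      have : T (V₀ + W) = T V₀ + T W := by
        simp only [T, Prod.mk_add_mk, Prod.fst_add, Prod.snd_add, Prod.mk.injEq]
        refine ⟨?_, ?_, ?_, ?_, ?_⟩ <;> module
      rw [this, add_right_comm, hT0, zero_add])
    (fun c W => by
      simp only [T, Prod.smul_fst, Prod.smul_snd, Prod.smul_mk, Prod.mk.injEq]
      refine ⟨?_, ?_, ?_, ?_, ?_⟩ <;> module)
    (by
      rintro ⟨y1, y2, y3, y4, y5⟩
      -- w2 = y5 + m w1 ; ga = w2 - y2 ; be = w1 + m al - y1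
      let w1 : A := (-χ⁻¹) • (y4 + (L0 * m) • (y5 - y2) - (2 * M0) • y5)
      let al : A := χ⁻¹ • (y3 - L0 • (- m • y1 - y5))
      refine ⟨(al, w1 + m • al - y1, y5 + m • w1 - y2, w1, y5 + m • w1), ?_⟩
      simp only [T, Prod.mk.injEq]
      refine ⟨by module, by module, ?_, ?_, by module⟩
      · have h1 : χ • al = (y3 - L0 • (- m • y1 - y5)) := smul_inv_smul₀ hχ _
        have h2 : y3 = χ • al + L0 • (- m • y1 - y5) := by rw [h1]; module
        rw [h2, hχd]
        module
      · have h1 : χ • w1 = - (y4 + (L0 * m) • (y5 - y2) - (2 * M0) • y5) := by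
          simp only [w1, neg_smul, smul_neg]
          rw [smul_inv_smul₀ hχ]
        have h2 : y4 = - (χ • w1) - (L0 * m) • (y5 - y2) + (2 * M0) • y5 := by rw [h1]; module
        rw [h2, hχd]
        module)
  refine ⟨η, hη, fun d L M N f1 f2 κ hd h1 h2 h3 h4 h5 h6 => ?_⟩
  obtain ⟨⟨al, be, ga, w1, w2⟩, hV⟩ := h (d, L, M, N, f1, f2, κ) (by
    simp only [Prod.mk_sub_mk, Prod.norm_mk, sub_zero, Real.norm_eq_abs]
    simp only [max_lt_iff]
    exact ⟨hd, h1, h2, h3, h4, h5, h6⟩)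
  simp only [F, Prod.mk_eq_zero] at hV
  obtain ⟨g1, g2, g3, g4, g5⟩ := hV
  exact ⟨al, be, ga, w1, w2, ⟨g1, g2, g3, g4, g5⟩⟩
end


theorem brioschi_alg (a b c a1 a2 b1 b2 c1 c2 a22 a12 b12 b11 c11 w1 w2 w11 w12 w21 k : ℝ)
    (ha : a ≠ 0) (hc : c ≠ 0)
    (r1 : w1 * c = b1 - a2) (r2 : w2 * a = w1 * b + c1)
    (r11 : w11 * c + w1 * c1 = b11 - a12) (r12 : w12 * c + w1 * c2 = b12 - a22)
    (r21 : w21 * a + w2 * a1 = w11 * b + w1 * b1 + c11)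
    (hk : w21 = w12 - k / 4 * (a * c)) :
    (1 / (2 * (a * a * (b * b + c * c) - (a * b) ^ 2) ^ 2)) *
    Matrix.det !![-(2 * a2 * a2 + 2 * a * a22) + 2 * (a12 * b + a2 * b1 + (a1 * b2 + a * b12))
          - (2 * b1 * b1 + 2 * b * b11 + (2 * c1 * c1 + 2 * c * c11)),
                    2 * a * a1, 2 * (a1 * b + a * b1) - 2 * a * a2;
                  2 * (a2 * b + a * b2) - (2 * b * b1 + 2 * c * c1), 2 * (a * a), 2 * (a * b);
                  2 * b * b2 + 2 * c * c2, 2 * (a * b), 2 * (b * b + c * c)]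
  - (1 / (2 * (a * a * (b * b + c * c) - (a * b) ^ 2) ^ 2)) *
    Matrix.det !![0, 2 * a * a2, 2 * b * b1 + 2 * c * c1;
                  2 * a * a2, 2 * (a * a), 2 * (a * b);
                  2 * b * b1 + 2 * c * c1, 2 * (a * b), 2 * (b * b + c * c)] = k := by
  have hb1 : b1 = a2 + w1 * c := by linarith
  have hc1 : c1 = w2 * a - w1 * b := by linarith
  have hb11 : b11 = a12 + (w11 * c + w1 * c1) := by linarith
  have hb12 : b12 = a22 + (w12 * c + w1 * c2) := by linarith
  have hc11 : c11 = w21 * a + w2 * a1 - w11 * b - w1 * b1 := by linarith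
  subst hk hc11 hb12 hb11 hc1 hb1
  have hD : a * a * (b * b + c * c) - (a * b) ^ 2 = (a * c) ^ 2 := by ring
  rw [hD, Matrix.det_fin_three, Matrix.det_fin_three]
  simp
  field_simp
  ring

theorem cod1_alg (a b c a1 a2 b1 b2 c1 c2 w1 w2 L M N f1 f2 : ℝ)
    (ha : a ≠ 0) (hc : c ≠ 0)
    (r1 : w1 * c = b1 - a2) (r2 : w2 * a = w1 * b + c1)
    (e3 : a * f1 - b * f2 + (b2 - c * w2) * L - 2 * (a2 * M) + a1 * N = 0)
    (e4 : c * f2 - (c2 + b * w2) * L + 2 * (a * w2 * M) - a * w1 * N = 0) :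
    f1 = -(((b * b + c * c) * (2 * (a2 * b + a * b2) - (2 * b * b1 + 2 * c * c1))
        - (a * b) * (2 * b * b2 + 2 * c * c2)) / (2 * (a * a * (b * b + c * c) - (a * b) ^ 2))) * L
      + 2 * (((b * b + c * c) * (2 * a * a2) - (a * b) * (2 * b * b1 + 2 * c * c1))
        / (2 * (a * a * (b * b + c * c) - (a * b) ^ 2))) * M
      - (((b * b + c * c) * (2 * a * a1) - (a * b) * (2 * (a1 * b + a * b1) - 2 * a * a2))
        / (2 * (a * a * (b * b + c * c) - (a * b) ^ 2))) * N := by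
  have hb1 : b1 = a2 + w1 * c := by linarith
  have hc1 : c1 = w2 * a - w1 * b := by linarith
  have hD : a * a * (b * b + c * c) - (a * b) ^ 2 = (a * c) ^ 2 := by ring
  have hf2 : f2 = ((c2 + b * w2) * L - 2 * (a * w2 * M) + a * w1 * N) / c := by
    field_simp; linarith
  have hf1 : f1 = (b * f2 - (b2 - c * w2) * L + 2 * (a2 * M) - a1 * N) / a := by
    field_simp; linarith
  rw [hD, hf1, hf2, hb1, hc1]
  field_simp
  ring

theorem cod2_alg (a b c a1 a2 b1 b2 c1 c2 w1 w2 L M N f2 : ℝ)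
    (ha : a ≠ 0) (hc : c ≠ 0)
    (r1 : w1 * c = b1 - a2) (r2 : w2 * a = w1 * b + c1)
    (e4 : c * f2 - (c2 + b * w2) * L + 2 * (a * w2 * M) - a * w1 * N = 0) :
    f2 = ((-(a * b) * (2 * (a2 * b + a * b2) - (2 * b * b1 + 2 * c * c1))
        + (a * a) * (2 * b * b2 + 2 * c * c2)) / (2 * (a * a * (b * b + c * c) - (a * b) ^ 2))) * L
      - 2 * ((-(a * b) * (2 * a * a2) + (a * a) * (2 * b * b1 + 2 * c * c1))
        / (2 * (a * a * (b * b + c * c) - (a * b) ^ 2))) * M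
      + ((-(a * b) * (2 * a * a1) + (a * a) * (2 * (a1 * b + a * b1) - 2 * a * a2))
        / (2 * (a * a * (b * b + c * c) - (a * b) ^ 2))) * N := by
  have hb1 : b1 = a2 + w1 * c := by linarith
  have hc1 : c1 = w2 * a - w1 * b := by linarith
  have hD : a * a * (b * b + c * c) - (a * b) ^ 2 = (a * c) ^ 2 := by ring
  have hf2 : f2 = ((c2 + b * w2) * L - 2 * (a * w2 * M) + a * w1 * N) / c := by
    field_simp; linarith
  rw [hD, hf2, hb1, hc1]
  field_simp
  ring


theorem hd_pdx1 {f : ℝ × ℝ × ℝ → ℝ} {q : ℝ × ℝ × ℝ} (hf : DifferentiableAt ℝ f q) :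
    HasDerivAt (fun s => f (s, q.2.1, q.2.2)) (fderiv ℝ f q (1, 0, 0)) q.1 := by
  have h : HasDerivAt (fun s : ℝ => (s, q.2.1, q.2.2)) ((1, 0, 0) : ℝ × ℝ × ℝ) q.1 :=
    (hasDerivAt_id q.1).prodMk ((hasDerivAt_const _ _).prodMk (hasDerivAt_const _ _))
  exact HasFDerivAt.comp_hasDerivAt (l := f) q.1 hf.hasFDerivAt h

theorem hd_pdx2 {f : ℝ × ℝ × ℝ → ℝ} {q : ℝ × ℝ × ℝ} (hf : DifferentiableAt ℝ f q) :
    HasDerivAt (fun s => f (q.1, s, q.2.2)) (fderiv ℝ f q (0, 1, 0)) q.2.1 := by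
  have h : HasDerivAt (fun s : ℝ => (q.1, s, q.2.2)) ((0, 1, 0) : ℝ × ℝ × ℝ) q.2.1 :=
    (hasDerivAt_const _ _).prodMk ((hasDerivAt_id q.2.1).prodMk (hasDerivAt_const _ _))
  exact HasFDerivAt.comp_hasDerivAt (l := f) q.2.1 hf.hasFDerivAt h

theorem hd_pdt {f : ℝ × ℝ × ℝ → ℝ} {q : ℝ × ℝ × ℝ} (hf : DifferentiableAt ℝ f q) :
    HasDerivAt (fun s => f (q.1, q.2.1, s)) (fderiv ℝ f q (0, 0, 1)) q.2.2 := by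
  have h : HasDerivAt (fun s : ℝ => (q.1, q.2.1, s)) ((0, 0, 1) : ℝ × ℝ × ℝ) q.2.2 :=
    (hasDerivAt_const _ _).prodMk ((hasDerivAt_const _ _).prodMk (hasDerivAt_id q.2.2))
  exact HasFDerivAt.comp_hasDerivAt (l := f) q.2.2 hf.hasFDerivAt h

theorem pdx1_eq {f : ℝ × ℝ × ℝ → ℝ} {q : ℝ × ℝ × ℝ} (hf : DifferentiableAt ℝ f q) :
    pdx1 f q = fderiv ℝ f q (1, 0, 0) := (hd_pdx1 hf).deriv
theorem pdx2_eq {f : ℝ × ℝ × ℝ → ℝ} {q : ℝ × ℝ × ℝ} (hf : DifferentiableAt ℝ f q) :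
    pdx2 f q = fderiv ℝ f q (0, 1, 0) := (hd_pdx2 hf).deriv
theorem pdt_eq {f : ℝ × ℝ × ℝ → ℝ} {q : ℝ × ℝ × ℝ} (hf : DifferentiableAt ℝ f q) :
    pdt f q = fderiv ℝ f q (0, 0, 1) := (hd_pdt hf).deriv

theorem analytic_pd {f pf : ℝ × ℝ × ℝ → ℝ} {U : Set (ℝ × ℝ × ℝ)} (hU : IsOpen U) (v : ℝ × ℝ × ℝ)
    (hf : AnalyticOnNhd ℝ f U)
    (hpf : ∀ q, DifferentiableAt ℝ f q → pf q = fderiv ℝ f q v) : AnalyticOnNhd ℝ pf U := by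
  intro q hq
  have h := ((ContinuousLinearMap.apply ℝ ℝ v).analyticAt _).comp (hf q hq).fderiv
  refine h.congr ?_
  filter_upwards [hU.mem_nhds hq] with x hx
  exact (hpf x (hf x hx).differentiableAt).symm

theorem analytic_pdx1 {f : ℝ × ℝ × ℝ → ℝ} {U : Set (ℝ × ℝ × ℝ)} (hU : IsOpen U)
    (hf : AnalyticOnNhd ℝ f U) : AnalyticOnNhd ℝ (pdx1 f) U :=
  analytic_pd hU _ hf fun _ h => pdx1_eq h
theorem analytic_pdx2 {f : ℝ × ℝ × ℝ → ℝ} {U : Set (ℝ × ℝ × ℝ)} (hU : IsOpen U)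
    (hf : AnalyticOnNhd ℝ f U) : AnalyticOnNhd ℝ (pdx2 f) U :=
  analytic_pd hU _ hf fun _ h => pdx2_eq h
theorem analytic_pdt {f : ℝ × ℝ × ℝ → ℝ} {U : Set (ℝ × ℝ × ℝ)} (hU : IsOpen U)
    (hf : AnalyticOnNhd ℝ f U) : AnalyticOnNhd ℝ (pdt f) U :=
  analytic_pd hU _ hf fun _ h => pdt_eq h

section rules
variable {f g : ℝ × ℝ × ℝ → ℝ} {q : ℝ × ℝ × ℝ}

theorem pdx1_congr {U : Set (ℝ × ℝ × ℝ)} (hU : IsOpen U) (hq : q ∈ U) (h : ∀ x ∈ U, f x = g x) :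
    pdx1 f q = pdx1 g q := by
  unfold pdx1
  apply Filter.EventuallyEq.deriv_eq
  have hc : Continuous fun s : ℝ => (s, q.2.1, q.2.2) := by fun_prop
  filter_upwards [(hU.preimage hc).mem_nhds hq] with s hs
  exact h _ hs

theorem pdx2_congr {U : Set (ℝ × ℝ × ℝ)} (hU : IsOpen U) (hq : q ∈ U) (h : ∀ x ∈ U, f x = g x) :
    pdx2 f q = pdx2 g q := by
  unfold pdx2
  apply Filter.EventuallyEq.deriv_eq
  have hc : Continuous fun s : ℝ => (q.1, s, q.2.2) := by fun_prop
  filter_upwards [(hU.preimage hc).mem_nhds hq] with s hs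
  exact h _ hs

theorem pdx1_mul (hf : DifferentiableAt ℝ f q) (hg : DifferentiableAt ℝ g q) :
    pdx1 (fun x => f x * g x) q = pdx1 f q * g q + f q * pdx1 g q := by
  rw [pdx1_eq hf, pdx1_eq hg]; exact ((hd_pdx1 hf).mul (hd_pdx1 hg)).deriv
theorem pdx2_mul (hf : DifferentiableAt ℝ f q) (hg : DifferentiableAt ℝ g q) :
    pdx2 (fun x => f x * g x) q = pdx2 f q * g q + f q * pdx2 g q := by
  rw [pdx2_eq hf, pdx2_eq hg]; exact ((hd_pdx2 hf).mul (hd_pdx2 hg)).deriv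
theorem pdx1_add (hf : DifferentiableAt ℝ f q) (hg : DifferentiableAt ℝ g q) :
    pdx1 (fun x => f x + g x) q = pdx1 f q + pdx1 g q := by
  rw [pdx1_eq hf, pdx1_eq hg]; exact ((hd_pdx1 hf).add (hd_pdx1 hg)).deriv
theorem pdx2_add (hf : DifferentiableAt ℝ f q) (hg : DifferentiableAt ℝ g q) :
    pdx2 (fun x => f x + g x) q = pdx2 f q + pdx2 g q := by
  rw [pdx2_eq hf, pdx2_eq hg]; exact ((hd_pdx2 hf).add (hd_pdx2 hg)).deriv
theorem pdx1_sub (hf : DifferentiableAt ℝ f q) (hg : DifferentiableAt ℝ g q) :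
    pdx1 (fun x => f x - g x) q = pdx1 f q - pdx1 g q := by
  rw [pdx1_eq hf, pdx1_eq hg]; exact ((hd_pdx1 hf).sub (hd_pdx1 hg)).deriv
theorem pdx2_sub (hf : DifferentiableAt ℝ f q) (hg : DifferentiableAt ℝ g q) :
    pdx2 (fun x => f x - g x) q = pdx2 f q - pdx2 g q := by
  rw [pdx2_eq hf, pdx2_eq hg]; exact ((hd_pdx2 hf).sub (hd_pdx2 hg)).deriv
theorem pdx1_neg : pdx1 (fun x => - f x) q = - pdx1 f q := by
  unfold pdx1; exact deriv.fun_neg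
theorem pdx2_neg : pdx2 (fun x => - f x) q = - pdx2 f q := by
  unfold pdx2; exact deriv.fun_neg

theorem pdx_comm {U : Set (ℝ × ℝ × ℝ)} (hU : IsOpen U) (hq : q ∈ U) (hf : AnalyticOnNhd ℝ f U) :
    pdx1 (pdx2 f) q = pdx2 (pdx1 f) q := by
  have hs : IsSymmSndFDerivAt ℝ f q :=
    ((hf q hq).contDiffAt (n := ⊤)).isSymmSndFDerivAt (by simp)
  have hd : DifferentiableAt ℝ (fderiv ℝ f) q := (hf q hq).fderiv.differentiableAt
  have aux : ∀ v : ℝ × ℝ × ℝ, HasFDerivAt (fun x => fderiv ℝ f x v)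
      ((ContinuousLinearMap.apply ℝ ℝ v).comp (fderiv ℝ (fderiv ℝ f) q)) q := fun v =>
    (ContinuousLinearMap.apply ℝ ℝ v).hasFDerivAt.comp q hd.hasFDerivAt
  rw [pdx1_congr hU hq (fun x hx => pdx2_eq (hf x hx).differentiableAt),
    pdx2_congr hU hq (fun x hx => pdx1_eq (hf x hx).differentiableAt),
    pdx1_eq (aux _).differentiableAt, pdx2_eq (aux _).differentiableAt, (aux _).fderiv,
    (aux _).fderiv]
  exact hs.eq _ _
end rules

/-- the geometric verification -/
theorem geometry {U : Set (ℝ × ℝ × ℝ)} (hU : IsOpen U)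
    {L M N f1 f2 κ a b c w1 w2 Ω P : ℝ × ℝ × ℝ → ℝ}
    (ha : AnalyticOnNhd ℝ a U) (hb : AnalyticOnNhd ℝ b U) (hc : AnalyticOnNhd ℝ c U)
    (hw1 : AnalyticOnNhd ℝ w1 U) (hw2 : AnalyticOnNhd ℝ w2 U)
    (hΩ : AnalyticOnNhd ℝ Ω U) (hP : AnalyticOnNhd ℝ P U)
    (ha0 : ∀ q ∈ U, a q ≠ 0) (hc0 : ∀ q ∈ U, c q ≠ 0)
    (r1 : ∀ q ∈ U, w1 q * c q = pdx1 b q - pdx2 a q)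
    (r2 : ∀ q ∈ U, w2 q * a q = w1 q * b q + pdx1 c q)
    (e3 : ∀ q ∈ U, a q * f1 q - b q * f2 q + (pdx2 b q - c q * w2 q) * L q
      - 2 * (pdx2 a q * M q) + pdx1 a q * N q = 0)
    (e4 : ∀ q ∈ U, c q * f2 q - (pdx2 c q + b q * w2 q) * L q
      + 2 * (a q * w2 q * M q) - a q * w1 q * N q = 0)
    (o1 : ∀ q ∈ U, pdx1 Ω q = w1 q) (o2 : ∀ q ∈ U, w2 q = pdx2 Ω q - P q)
    (o3 : ∀ q ∈ U, pdx1 P q = κ q / 4 * (a q * c q))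
    (hf1 : ∀ q ∈ U, pdx1 N q - pdx2 M q = f1 q) (hf2 : ∀ q ∈ U, pdx1 M q - pdx2 L q = f2 q)
    (hκ : ∀ q ∈ U, L q * N q - (M q) ^ 2 = κ q) :
    (∀ q ∈ U, 0 < detg (fun q => a q * a q) (fun q => a q * b q)
        (fun q => b q * b q + c q * c q) q) ∧
    (∀ q ∈ U, GaussCodazzi L M N (fun q => a q * a q) (fun q => a q * b q)
        (fun q => b q * b q + c q * c q) q) ∧
    (∀ q ∈ U, brioschi (fun q => a q * a q) (fun q => a q * b q)
        (fun q => b q * b q + c q * c q) q = κ q) := by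
  have da := fun q hq => (ha q hq).differentiableAt
  have db := fun q hq => (hb q hq).differentiableAt
  have dc := fun q hq => (hc q hq).differentiableAt
  have dw1 := fun q hq => (hw1 q hq).differentiableAt
  have dw2 := fun q hq => (hw2 q hq).differentiableAt
  have da1 := fun q hq => (analytic_pdx1 hU ha q hq).differentiableAt
  have da2 := fun q hq => (analytic_pdx2 hU ha q hq).differentiableAt
  have db1 := fun q hq => (analytic_pdx1 hU hb q hq).differentiableAt
  have db2 := fun q hq => (analytic_pdx2 hU hb q hq).differentiableAt
  have dc1 := fun q hq => (analytic_pdx1 hU hc q hq).differentiableAt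
  have dbb := fun q hq => (db q hq).fun_mul (db q hq)
  have dcc := fun q hq => (dc q hq).fun_mul (dc q hq)
  -- first derivatives of the metric
  have g11_1 : ∀ q ∈ U, pdx1 (fun q => a q * a q) q = 2 * a q * pdx1 a q := fun q hq => by
    rw [pdx1_mul (da q hq) (da q hq)]; ring
  have g11_2 : ∀ q ∈ U, pdx2 (fun q => a q * a q) q = 2 * a q * pdx2 a q := fun q hq => by
    rw [pdx2_mul (da q hq) (da q hq)]; ring
  have g12_1 : ∀ q ∈ U, pdx1 (fun q => a q * b q) q = pdx1 a q * b q + a q * pdx1 b q :=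
    fun q hq => pdx1_mul (da q hq) (db q hq)
  have g12_2 : ∀ q ∈ U, pdx2 (fun q => a q * b q) q = pdx2 a q * b q + a q * pdx2 b q :=
    fun q hq => pdx2_mul (da q hq) (db q hq)
  have g22_1 : ∀ q ∈ U, pdx1 (fun q => b q * b q + c q * c q) q =
      2 * b q * pdx1 b q + 2 * c q * pdx1 c q := fun q hq => by
    rw [pdx1_add (dbb q hq) (dcc q hq), pdx1_mul (db q hq) (db q hq),
      pdx1_mul (dc q hq) (dc q hq)]; ring
  have g22_2 : ∀ q ∈ U, pdx2 (fun q => b q * b q + c q * c q) q =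
      2 * b q * pdx2 b q + 2 * c q * pdx2 c q := fun q hq => by
    rw [pdx2_add (dbb q hq) (dcc q hq), pdx2_mul (db q hq) (db q hq),
      pdx2_mul (dc q hq) (dc q hq)]; ring
  have hbri : ∀ q ∈ U, brioschi (fun q => a q * a q) (fun q => a q * b q)
        (fun q => b q * b q + c q * c q) q = κ q := by
    intro q hq
    have s1 : pdx2 (pdx2 (fun q => a q * a q)) q =
        2 * pdx2 a q * pdx2 a q + 2 * a q * pdx2 (pdx2 a) q := by
      have : pdx2 (pdx2 (fun q => a q * a q)) q = pdx2 (fun q => a q * pdx2 a q + a q * pdx2 a q) q :=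
        pdx2_congr hU hq (fun x hx => by rw [g11_2 x hx]; ring)
      have dm := (da q hq).fun_mul (da2 q hq)
      rw [this, pdx2_add dm dm, pdx2_mul (da q hq) (da2 q hq)]
      ring
    have s2 : pdx1 (pdx2 (fun q => a q * b q)) q =
        pdx1 (pdx2 a) q * b q + pdx2 a q * pdx1 b q
          + (pdx1 a q * pdx2 b q + a q * pdx1 (pdx2 b) q) := by
      rw [pdx1_congr hU hq g12_2, pdx1_add ((da2 q hq).fun_mul (db q hq)) ((da q hq).fun_mul (db2 q hq)),
        pdx1_mul (da2 q hq) (db q hq), pdx1_mul (da q hq) (db2 q hq)]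
    have s3 : pdx1 (pdx1 (fun q => b q * b q + c q * c q)) q =
        2 * pdx1 b q * pdx1 b q + 2 * b q * pdx1 (pdx1 b) q
          + (2 * pdx1 c q * pdx1 c q + 2 * c q * pdx1 (pdx1 c) q) := by
      have : pdx1 (pdx1 (fun q => b q * b q + c q * c q)) q =
          pdx1 (fun q => (b q * pdx1 b q + b q * pdx1 b q) + (c q * pdx1 c q + c q * pdx1 c q)) q :=
        pdx1_congr hU hq (fun x hx => by rw [g22_1 x hx]; ring)
      have dm := (db q hq).fun_mul (db1 q hq)
      have dn := (dc q hq).fun_mul (dc1 q hq)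
      rw [this, pdx1_add (dm.fun_add dm) (dn.fun_add dn), pdx1_add dm dm, pdx1_add dn dn,
        pdx1_mul (db q hq) (db1 q hq), pdx1_mul (dc q hq) (dc1 q hq)]
      ring
    have r11 : pdx1 w1 q * c q + w1 q * pdx1 c q = pdx1 (pdx1 b) q - pdx1 (pdx2 a) q := by
      have := pdx1_congr hU hq r1
      rwa [pdx1_mul (dw1 q hq) (dc q hq), pdx1_sub (db1 q hq) (da2 q hq)] at this
    have r12 : pdx2 w1 q * c q + w1 q * pdx2 c q = pdx1 (pdx2 b) q - pdx2 (pdx2 a) q := by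
      have := pdx2_congr hU hq r1
      rwa [pdx2_mul (dw1 q hq) (dc q hq), pdx2_sub (db1 q hq) (da2 q hq), ← pdx_comm hU hq hb]
        at this
    have r21 : pdx1 w2 q * a q + w2 q * pdx1 a q =
        pdx1 w1 q * b q + w1 q * pdx1 b q + pdx1 (pdx1 c) q := by
      have := pdx1_congr hU hq r2
      rwa [pdx1_mul (dw2 q hq) (da q hq), pdx1_add ((dw1 q hq).fun_mul (db q hq)) (dc1 q hq),
        pdx1_mul (dw1 q hq) (db q hq)] at this
    have hk : pdx1 w2 q = pdx2 w1 q - κ q / 4 * (a q * c q) := by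
      rw [pdx1_congr hU hq o2, pdx1_sub (analytic_pdx2 hU hΩ q hq).differentiableAt
        (hP q hq).differentiableAt, pdx_comm hU hq hΩ, pdx2_congr hU hq o1, o3 q hq]
    have key := brioschi_alg (a q) (b q) (c q) (pdx1 a q) (pdx2 a q) (pdx1 b q) (pdx2 b q)
      (pdx1 c q) (pdx2 c q) _ _ _ _ _ _ _ _ _ _ (κ q) (ha0 q hq) (hc0 q hq) (r1 q hq) (r2 q hq)
      r11 r12 r21 hk
    unfold brioschi detg
    rw [s1, s2, s3, g11_1 q hq, g11_2 q hq, g12_1 q hq, g12_2 q hq, g22_1 q hq, g22_2 q hq]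
    exact key
  refine ⟨?_, ?_, hbri⟩
  · intro q hq
    unfold detg
    have : a q * a q * (b q * b q + c q * c q) - (a q * b q) ^ 2 = (a q * c q) ^ 2 := by ring
    simp only [this]
    have := mul_ne_zero (ha0 q hq) (hc0 q hq)
    positivity
  · intro q hq
    refine ⟨?_, ?_, ?_⟩
    · rw [hf1 q hq]
      unfold Gamma1_22 Gamma1_12 Gamma1_11 detg
      rw [g11_1 q hq, g11_2 q hq, g12_1 q hq, g12_2 q hq, g22_1 q hq, g22_2 q hq]
      exact cod1_alg _ _ _ _ _ _ _ _ _ _ _ _ _ _ _ (f2 q) (ha0 q hq) (hc0 q hq) (r1 q hq)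
        (r2 q hq) (e3 q hq) (e4 q hq)
    · rw [hf2 q hq]
      unfold Gamma2_22 Gamma2_12 Gamma2_11 detg
      rw [g11_1 q hq, g11_2 q hq, g12_1 q hq, g12_2 q hq, g22_1 q hq, g22_2 q hq]
      exact cod2_alg _ _ _ _ _ _ _ _ _ _ _ _ _ _ (f2 q) (ha0 q hq) (hc0 q hq) (r1 q hq)
        (r2 q hq) (e4 q hq)
    · rw [hκ q hq, hbri q hq]


namespace PS

theorem ev_add (q : ℝ × ℝ × ℝ) (a b : PS) : ev q (a + b) = ev q a + ev q b := map_add _ _ _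
theorem ev_sub (q : ℝ × ℝ × ℝ) (a b : PS) : ev q (a - b) = ev q a - ev q b := map_sub _ _ _
theorem ev_smul (q : ℝ × ℝ × ℝ) (r : ℝ) (a : PS) : ev q (r • a) = r * ev q a := by
  rw [map_smul, smul_eq_mul]

theorem ev_J_zero {q : ℝ × ℝ × ℝ} (hq : q ∈ Om) (h0 : q.1 = 0) (a : PS) : ev q (J a) = 0 := by
  rw [← (ev_comp_apply J a).tsum_eq]
  simp [ev_Je hq, mon, h0]

theorem fderiv_ev_J {q : ℝ × ℝ × ℝ} (hq : q ∈ Om) (a : PS) :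
    fderiv ℝ (fun q => ev q (J a)) q (1, 0, 0) = ev q a ∧
    fderiv ℝ (fun q => ev q (J a)) q (0, 1, 0) = ev q (K a) := by
  obtain ⟨s, r, t⟩ := q
  have hd := (analytic_ev (J a) _ hq).differentiableAt
  exact ⟨(hd_pdx1 hd).unique (hasDerivAt_ev_J_s hq a), (hd_pdx2 hd).unique (hasDerivAt_ev_J_r hq a)⟩

/-- the coordinate change -/
noncomputable def Q (x1 x2 m d : ℝ) (q : ℝ × ℝ × ℝ) : ℝ × ℝ × ℝ :=
  ((q.1 - x1 + m * (q.2.1 - x2)) / d ^ 2, (q.2.1 - x2) / d, q.2.2 / d)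

theorem analytic_Q (x1 x2 m d : ℝ) (q : ℝ × ℝ × ℝ) : AnalyticAt ℝ (Q x1 x2 m d) q := by
  have h1 : AnalyticAt ℝ (fun q : ℝ × ℝ × ℝ => q.1) q := analyticAt_fst
  have h2 : AnalyticAt ℝ (fun q : ℝ × ℝ × ℝ => q.2.1) q := analyticAt_fst.comp analyticAt_snd
  have h3 : AnalyticAt ℝ (fun q : ℝ × ℝ × ℝ => q.2.2) q := analyticAt_snd.comp analyticAt_snd
  have e1 : AnalyticAt ℝ (fun q : ℝ × ℝ × ℝ => (q.1 - x1 + m * (q.2.1 - x2)) / d ^ 2) q := by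
    simp only [div_eq_mul_inv]; fun_prop
  have e2 : AnalyticAt ℝ (fun q : ℝ × ℝ × ℝ => (q.2.1 - x2) / d) q := by
    simp only [div_eq_mul_inv]; fun_prop
  have e3 : AnalyticAt ℝ (fun q : ℝ × ℝ × ℝ => q.2.2 / d) q := by
    simp only [div_eq_mul_inv]; fun_prop
  exact e1.prod (e2.prod e3)

theorem analytic_evQ (x1 x2 m d : ℝ) (a : PS) :
    AnalyticOnNhd ℝ (fun q => ev (Q x1 x2 m d q) a) (Q x1 x2 m d ⁻¹' Om) := fun q hq =>
  AnalyticAt.comp (g := fun q => ev q a) (analytic_ev a _ hq) (analytic_Q x1 x2 m d q)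

theorem pdx1_evQ (x1 x2 m d : ℝ) (a : PS) {q : ℝ × ℝ × ℝ} (hq : Q x1 x2 m d q ∈ Om) :
    pdx1 (fun q => ev (Q x1 x2 m d q) (J a)) q = ev (Q x1 x2 m d q) a / d ^ 2 := by
  have h : HasDerivAt (fun s : ℝ => Q x1 x2 m d (s, q.2.1, q.2.2))
      ((1 / d ^ 2, 0, 0) : ℝ × ℝ × ℝ) q.1 := by
    refine HasDerivAt.prodMk ?_ ((hasDerivAt_const _ ((q.2.1 - x2) / d)).prodMk
      (hasDerivAt_const _ (q.2.2 / d)))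
    exact (((hasDerivAt_id q.1).sub_const x1).add_const (m * (q.2.1 - x2))).div_const (d ^ 2)
  have hf := (analytic_ev (J a) _ hq).differentiableAt.hasFDerivAt
  have := (HasFDerivAt.comp_hasDerivAt (l := fun q => ev q (J a)) q.1 hf h).deriv
  have h2 : ((1 / d ^ 2, 0, 0) : ℝ × ℝ × ℝ) = (1 / d ^ 2) • (1, 0, 0) := by simp
  refine this.trans ?_
  rw [h2, map_smul, (fderiv_ev_J hq a).1, smul_eq_mul]; ring

theorem pdx2_evQ (x1 x2 m d : ℝ) (a : PS) {q : ℝ × ℝ × ℝ} (hq : Q x1 x2 m d q ∈ Om) :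
    pdx2 (fun q => ev (Q x1 x2 m d q) (J a)) q =
      m * ev (Q x1 x2 m d q) a / d ^ 2 + ev (Q x1 x2 m d q) (K a) / d := by
  have h : HasDerivAt (fun s : ℝ => Q x1 x2 m d (q.1, s, q.2.2))
      ((m / d ^ 2, 1 / d, 0) : ℝ × ℝ × ℝ) q.2.1 := by
    have h0 := (hasDerivAt_id q.2.1).sub_const x2
    refine HasDerivAt.prodMk ?_ ((h0.div_const _).prodMk (hasDerivAt_const _ (q.2.2 / d)))
    simpa using ((h0.const_mul m).const_add (q.1 - x1)).div_const (d ^ 2)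
  have hf := (analytic_ev (J a) _ hq).differentiableAt.hasFDerivAt
  have := (HasFDerivAt.comp_hasDerivAt (l := fun q => ev q (J a)) q.2.1 hf h).deriv
  have h2 : ((m / d ^ 2, 1 / d, 0) : ℝ × ℝ × ℝ) =
      (m / d ^ 2) • (1, 0, 0) + (1 / d) • (0, 1, 0) := by simp
  refine this.trans ?_
  rw [h2, map_add, map_smul, map_smul, (fderiv_ev_J hq a).1, (fderiv_ev_J hq a).2, smul_eq_mul,
    smul_eq_mul]; ring

theorem pdx_lin (x1 x2 m d r : ℝ) (hd : d ≠ 0) (a : PS) {q : ℝ × ℝ × ℝ}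
    (hq : Q x1 x2 m d q ∈ Om) :
    pdx1 (fun q => r + d ^ 2 * ev (Q x1 x2 m d q) (J a)) q = ev (Q x1 x2 m d q) a ∧
    pdx2 (fun q => r + d ^ 2 * ev (Q x1 x2 m d q) (J a)) q =
      m * ev (Q x1 x2 m d q) a + d * ev (Q x1 x2 m d q) (K a) := by
  have h1 := pdx1_evQ x1 x2 m d a hq
  have h2 := pdx2_evQ x1 x2 m d a hq
  unfold pdx1 at h1 ⊢
  unfold pdx2 at h2 ⊢
  constructor
  · rw [deriv_const_add', deriv_const_mul_field, h1]; field_simp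
  · rw [deriv_const_add', deriv_const_mul_field, h2]; field_simp

end PS

open PS in
theorem local_sol (x1 x2 m : ℝ) (L M N f1 f2 κ : ℝ × ℝ × ℝ → ℝ)
    (hL : AnalyticAt ℝ L (x1, x2, 0)) (hM : AnalyticAt ℝ M (x1, x2, 0))
    (hN : AnalyticAt ℝ N (x1, x2, 0)) (hf1 : AnalyticAt ℝ f1 (x1, x2, 0))
    (hf2 : AnalyticAt ℝ f2 (x1, x2, 0)) (hκ : AnalyticAt ℝ κ (x1, x2, 0))
    (hχ : N (x1, x2, 0) - 2 * m * M (x1, x2, 0) + m ^ 2 * L (x1, x2, 0) ≠ 0) :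
    ∃ U : Set (ℝ × ℝ × ℝ), IsOpen U ∧ (x1, x2, 0) ∈ U ∧ ∃ a b c w1 w2 Ω P : ℝ × ℝ × ℝ → ℝ,
    AnalyticOnNhd ℝ a U ∧ AnalyticOnNhd ℝ b U ∧ AnalyticOnNhd ℝ c U ∧
    AnalyticOnNhd ℝ w1 U ∧ AnalyticOnNhd ℝ w2 U ∧
    AnalyticOnNhd ℝ Ω U ∧ AnalyticOnNhd ℝ P U ∧
    a (x1, x2, 0) ≠ 0 ∧ c (x1, x2, 0) ≠ 0 ∧
    (∀ q ∈ U, w1 q * c q = pdx1 b q - pdx2 a q) ∧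
    (∀ q ∈ U, w2 q * a q = w1 q * b q + pdx1 c q) ∧
    (∀ q ∈ U, a q * f1 q - b q * f2 q + (pdx2 b q - c q * w2 q) * L q
      - 2 * (pdx2 a q * M q) + pdx1 a q * N q = 0) ∧
    (∀ q ∈ U, c q * f2 q - (pdx2 c q + b q * w2 q) * L q
      + 2 * (a q * w2 q * M q) - a q * w1 q * N q = 0) ∧
    (∀ q ∈ U, pdx1 Ω q = w1 q) ∧ (∀ q ∈ U, w2 q = pdx2 Ω q - P q) ∧
    (∀ q ∈ U, pdx1 P q = κ q * (a q * c q)) := by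
  let Ψ : ℝ × ℝ × ℝ → ℝ × ℝ × ℝ := fun q => (x1 + q.1 - m * q.2.1, x2 + q.2.1, q.2.2)
  have hΨ0 : Ψ 0 = (x1, x2, 0) := by simp [Ψ]
  have hΨ : AnalyticAt ℝ Ψ 0 := by
    have h1 : AnalyticAt ℝ (fun q : ℝ × ℝ × ℝ => q.1) 0 := analyticAt_fst
    have h2 : AnalyticAt ℝ (fun q : ℝ × ℝ × ℝ => q.2.1) 0 := analyticAt_fst.comp analyticAt_snd
    have h3 : AnalyticAt ℝ (fun q : ℝ × ℝ × ℝ => q.2.2) 0 := analyticAt_snd.comp analyticAt_snd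
    have e1 : AnalyticAt ℝ (fun q : ℝ × ℝ × ℝ => x1 + q.1 - m * q.2.1) 0 := by fun_prop
    have e2 : AnalyticAt ℝ (fun q : ℝ × ℝ × ℝ => x2 + q.2.1) 0 := by fun_prop
    exact e1.prod (e2.prod h3)
  obtain ⟨η, hη, hsol⟩ := exists_sol mul one J K PS.one_mul PS.mul_one m _ _ _
    (f1 (x1, x2, 0)) (f2 (x1, x2, 0)) (κ (x1, x2, 0)) hχ
  have rep : ∀ f : ℝ × ℝ × ℝ → ℝ, AnalyticAt ℝ f (x1, x2, 0) → ∃ d₀ > 0, ∀ d, 0 < d → d < d₀ →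
      ∃ A : PS, ‖A - f (x1, x2, 0) • one‖ < η ∧
        ∀ q, Q x1 x2 m d q ∈ Om → ev (Q x1 x2 m d q) A = f q := by
    intro f hf
    have hc : AnalyticAt ℝ (fun q => f (Ψ q)) 0 :=
      AnalyticAt.comp (g := f) (by rw [hΨ0]; exact hf) hΨ
    obtain ⟨d₀, h0, h⟩ := repr_exists hc hη
    refine ⟨d₀, h0, fun d hd hd' => ?_⟩
    obtain ⟨A, hA, hA'⟩ := h d hd hd'
    refine ⟨A, by simpa only [hΨ0] using hA, fun q hq => ?_⟩
    rw [hA' _ hq]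
    congr 1
    simp only [Ψ, Q]
    ext
    · simp only; field_simp; ring
    · simp only; field_simp; ring
    · simp only; field_simp
  obtain ⟨dL, pL, rL⟩ := rep L hL
  obtain ⟨dM, pM, rM⟩ := rep M hM
  obtain ⟨dN, pN, rN⟩ := rep N hN
  obtain ⟨d1, p1, r1⟩ := rep f1 hf1
  obtain ⟨d2, p2, r2⟩ := rep f2 hf2
  obtain ⟨dκ, pκ, rκ⟩ := rep κ hκ
  obtain ⟨d, hd, hd'⟩ : ∃ d, 0 < d ∧ d < min (min (min dL dM) (min dN d1)) (min (min d2 dκ) η) :=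
    exists_between (by simp only [lt_min_iff]; exact ⟨⟨⟨pL, pM⟩, pN, p1⟩, ⟨p2, pκ⟩, hη⟩)
  simp only [lt_min_iff] at hd'
  obtain ⟨⟨⟨lL, lM⟩, lN, l1⟩, ⟨l2, lκ⟩, lη⟩ := hd'
  obtain ⟨AL, nL, vL⟩ := rL d hd lL
  obtain ⟨AM, nM, vM⟩ := rM d hd lM
  obtain ⟨AN, nN, vN⟩ := rN d hd lN
  obtain ⟨A1, n1, v1⟩ := r1 d hd l1
  obtain ⟨A2, n2, v2⟩ := r2 d hd l2
  obtain ⟨Aκ, nκ, vκ⟩ := rκ d hd lκ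
  obtain ⟨al, be, ga, w1, w2, s1, s2, s3, s4, s5⟩ :=
    hsol d AL AM AN A1 A2 Aκ (by rwa [abs_of_pos hd]) nL nM nN n1 n2 nκ
  have hd0 := hd.ne'
  have hQ0 : Q x1 x2 m d (x1, x2, 0) = 0 := by simp [Q]
  have h0 : (0 : ℝ × ℝ × ℝ) ∈ Om := by simp [Om]
  have hlin : ∀ (r : ℝ) (y : PS), AnalyticOnNhd ℝ
      (fun q => r + d ^ 2 * ev (Q x1 x2 m d q) (J y)) (Q x1 x2 m d ⁻¹' Om) := fun r y =>
    analyticOnNhd_const.add (analyticOnNhd_const.mul (analytic_evQ x1 x2 m d (J y)))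
  set G := mul Aκ (mul (one + d ^ 2 • J al) (one + d ^ 2 • J ga)) with hG
  refine ⟨Q x1 x2 m d ⁻¹' Om, isOpen_Om.preimage ?_, by rw [Set.mem_preimage, hQ0]; exact h0,
    fun q => 1 + d ^ 2 * ev (Q x1 x2 m d q) (J al), fun q => 0 + d ^ 2 * ev (Q x1 x2 m d q) (J be),
    fun q => 1 + d ^ 2 * ev (Q x1 x2 m d q) (J ga), fun q => ev (Q x1 x2 m d q) w1,
    fun q => ev (Q x1 x2 m d q) w2, fun q => 0 + d ^ 2 * ev (Q x1 x2 m d q) (J w1),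
    fun q => 0 + d ^ 2 * ev (Q x1 x2 m d q) (J G),
    hlin _ _, hlin _ _, hlin _ _, analytic_evQ _ _ _ _ _, analytic_evQ _ _ _ _ _, hlin _ _,
    hlin _ _, ?_, ?_, ?_, ?_, ?_, ?_, ?_, ?_, ?_⟩
  · exact continuous_iff_continuousAt.2 fun q => (analytic_Q x1 x2 m d q).continuousAt
  · simp [hQ0, ev_J_zero h0]
  · simp [hQ0, ev_J_zero h0]
  all_goals
    intro q hq
    rw [Set.mem_preimage] at hq
  · rw [(pdx_lin x1 x2 m d 0 hd0 be hq).1, (pdx_lin x1 x2 m d 1 hd0 al hq).2]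
    have := congrArg (ev (Q x1 x2 m d q)) s1
    simp only [ev_add, ev_sub, ev_smul, ev_mul hq, ev_one hq, map_zero] at this
    linear_combination this
  · rw [(pdx_lin x1 x2 m d 1 hd0 ga hq).1]
    have := congrArg (ev (Q x1 x2 m d q)) s2
    simp only [ev_add, ev_sub, ev_smul, ev_mul hq, ev_one hq, map_zero] at this
    linear_combination this
  · rw [(pdx_lin x1 x2 m d 0 hd0 be hq).2, (pdx_lin x1 x2 m d 1 hd0 al hq).2,
      (pdx_lin x1 x2 m d 1 hd0 al hq).1]
    have := congrArg (ev (Q x1 x2 m d q)) s3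
    simp only [ev_add, ev_sub, ev_smul, ev_mul hq, ev_one hq, map_zero,
      vL q hq, vM q hq, vN q hq, v1 q hq, v2 q hq] at this
    linear_combination this
  · rw [(pdx_lin x1 x2 m d 1 hd0 ga hq).2]
    have := congrArg (ev (Q x1 x2 m d q)) s4
    simp only [ev_add, ev_sub, ev_smul, ev_mul hq, ev_one hq, map_zero,
      vL q hq, vM q hq, vN q hq, v1 q hq, v2 q hq] at this
    linear_combination this
  · rw [(pdx_lin x1 x2 m d 0 hd0 w1 hq).1]
  · rw [(pdx_lin x1 x2 m d 0 hd0 w1 hq).2]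
    have := congrArg (ev (Q x1 x2 m d q)) s5
    simp only [ev_add, ev_sub, ev_smul, map_zero] at this
    linear_combination this
  · rw [(pdx_lin x1 x2 m d 0 hd0 G hq).1, hG]
    simp only [ev_add, ev_smul, ev_mul hq, ev_one hq, vκ q hq]

/-- Corollary 5.1: an analytic local solution `(u, v, p)` of the incompressible Euler
equations with `u(x₀,0)v(x₀,0) ≠ 0` defines a time-evolving metric `g` (analytic,
with `det g > 0`) satisfying the Gauss–Codazzi equations with `L = v² + p`,
`M = −uv`, `N = u² + p` and Gauss curvature `p² + p(u² + v²)`. -/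
theorem statement10 (W : Set (ℝ × ℝ)) (hW : IsOpen W) (T : ℝ) (hT : 0 < T)
    (u v p : ℝ × ℝ × ℝ → ℝ)
    (D : Set (ℝ × ℝ × ℝ))
    (hD : D = {q : ℝ × ℝ × ℝ | (q.1, q.2.1) ∈ W ∧ q.2.2 ∈ Set.Ioo (-T) T})
    (hu : AnalyticOnNhd ℝ u D) (hv : AnalyticOnNhd ℝ v D) (hp : AnalyticOnNhd ℝ p D)
    (hmom1 : ∀ q ∈ D, pdx1 (fun r => (u r) ^ 2 + p r) q + pdx2 (fun r => u r * v r) q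
      = -(pdt u q))
    (hmom2 : ∀ q ∈ D, pdx1 (fun r => u r * v r) q + pdx2 (fun r => (v r) ^ 2 + p r) q
      = -(pdt v q))
    (hdiv : ∀ q ∈ D, pdx1 u q + pdx2 v q = 0)
    (x₀ : ℝ × ℝ) (hx₀ : x₀ ∈ W)
    (hne : u (x₀.1, x₀.2, 0) * v (x₀.1, x₀.2, 0) ≠ 0) :
    ∃ (W' : Set (ℝ × ℝ)) (T' : ℝ), IsOpen W' ∧ x₀ ∈ W' ∧ W' ⊆ W ∧ 0 < T' ∧ T' ≤ T ∧
    ∃ g11 g12 g22 : ℝ × ℝ × ℝ → ℝ, ∃ D' : Set (ℝ × ℝ × ℝ),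
      D' = {q : ℝ × ℝ × ℝ | (q.1, q.2.1) ∈ W' ∧ q.2.2 ∈ Set.Ioo (-T') T'} ∧
      AnalyticOnNhd ℝ g11 D' ∧ AnalyticOnNhd ℝ g12 D' ∧ AnalyticOnNhd ℝ g22 D' ∧
      (∀ q ∈ D', 0 < detg g11 g12 g22 q) ∧
      (∀ q ∈ D', GaussCodazzi (fun r => (v r) ^ 2 + p r) (fun r => -(u r * v r))
        (fun r => (u r) ^ 2 + p r) g11 g12 g22 q) ∧
      (∀ q ∈ D', brioschi g11 g12 g22 q = (p q) ^ 2 + p q * ((u q) ^ 2 + (v q) ^ 2)) := by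
  subst hD
  set D := {q : ℝ × ℝ × ℝ | (q.1, q.2.1) ∈ W ∧ q.2.2 ∈ Set.Ioo (-T) T} with hDd
  have hDo : IsOpen D :=
    (hW.preimage (continuous_fst.prodMk (continuous_fst.comp continuous_snd))).inter
      (isOpen_Ioo.preimage (continuous_snd.comp continuous_snd))
  have hpt : (x₀.1, x₀.2, (0 : ℝ)) ∈ D := ⟨hx₀, by simp [hT]⟩
  let L : ℝ × ℝ × ℝ → ℝ := fun r => (v r) ^ 2 + p r
  let M : ℝ × ℝ × ℝ → ℝ := fun r => -(u r * v r)
  let N : ℝ × ℝ × ℝ → ℝ := fun r => (u r) ^ 2 + p r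
  let κ : ℝ × ℝ × ℝ → ℝ := fun q => (p q) ^ 2 + p q * ((u q) ^ 2 + (v q) ^ 2)
  let f1 : ℝ × ℝ × ℝ → ℝ := fun q => -(pdt u q)
  let f2 : ℝ × ℝ × ℝ → ℝ := fun q => pdt v q
  have hL : AnalyticOnNhd ℝ L D := (hv.pow 2).add hp
  have hM : AnalyticOnNhd ℝ M D := (hu.mul hv).neg
  have hN : AnalyticOnNhd ℝ N D := (hu.pow 2).add hp
  have hκ : AnalyticOnNhd ℝ κ D := (hp.pow 2).add (hp.mul ((hu.pow 2).add (hv.pow 2)))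
  have hκ4 : AnalyticOnNhd ℝ (fun q => κ q * (1 / 4)) D := hκ.mul analyticOnNhd_const
  have hf1 : AnalyticOnNhd ℝ f1 D := (analytic_pdt hDo hu).neg
  have hf2 : AnalyticOnNhd ℝ f2 D := analytic_pdt hDo hv
  have hM0 : M (x₀.1, x₀.2, 0) ≠ 0 := neg_ne_zero.2 hne
  obtain ⟨m, hm⟩ : ∃ m : ℝ, N (x₀.1, x₀.2, 0) - 2 * m * M (x₀.1, x₀.2, 0)
      + m ^ 2 * L (x₀.1, x₀.2, 0) ≠ 0 := by
    by_contra! h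
    have h0 := h 0
    have h1 := h 1
    have h2 := h (-1)
    apply hM0
    linarith
  obtain ⟨U, hU, hptU, a, b, c, w1, w2, Ω, P, ha, hb, hc, hw1, hw2, hΩ, hP, ha0, hc0, r1, r2, e3, e4,
    o1, o2, o3⟩ := local_sol x₀.1 x₀.2 m L M N f1 f2 (fun q => κ q * (1 / 4)) (hL _ hpt) (hM _ hpt)
      (hN _ hpt) (hf1 _ hpt) (hf2 _ hpt) (hκ4 _ hpt) hm
  have hnb : {q | q ∈ U ∧ q ∈ D ∧ a q ≠ 0 ∧ c q ≠ 0} ∈ nhds (x₀.1, x₀.2, (0 : ℝ)) := by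
    filter_upwards [hU.mem_nhds hptU, hDo.mem_nhds hpt,
      (ha _ hptU).continuousAt.eventually_ne ha0, (hc _ hptU).continuousAt.eventually_ne hc0]
      with q h1 h2 h3 h4
    exact ⟨h1, h2, h3, h4⟩
  obtain ⟨ε, hε, hball⟩ := Metric.mem_nhds_iff.1 hnb
  have hx : ∀ q ∈ {q : ℝ × ℝ × ℝ | (q.1, q.2.1) ∈ W ∩ Metric.ball x₀ ε ∧
      q.2.2 ∈ Set.Ioo (-(min T ε)) (min T ε)}, q ∈ U ∧ q ∈ D ∧ a q ≠ 0 ∧ c q ≠ 0 := by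
    rintro ⟨y1, y2, t⟩ ⟨⟨-, h1⟩, h2⟩
    apply hball
    simp only [Metric.mem_ball, Prod.dist_eq, max_lt_iff, Real.dist_eq, Set.mem_Ioo] at h1 h2 ⊢
    refine ⟨h1.1, h1.2, ?_⟩
    rw [sub_zero]
    exact (abs_lt.2 h2).trans_le (min_le_right _ _)
  set D' := {q : ℝ × ℝ × ℝ | (q.1, q.2.1) ∈ W ∩ Metric.ball x₀ ε ∧
      q.2.2 ∈ Set.Ioo (-(min T ε)) (min T ε)} with hD'
  have hWo : IsOpen (W ∩ Metric.ball x₀ ε) := hW.inter Metric.isOpen_ball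
  have hDo' : IsOpen D' :=
    (hWo.preimage (continuous_fst.prodMk (continuous_fst.comp continuous_snd))).inter
      (isOpen_Ioo.preimage (continuous_snd.comp continuous_snd))
  have hsub : D' ⊆ U := fun q hq => (hx q hq).1
  have hsubD : D' ⊆ D := fun q hq => (hx q hq).2.1
  obtain ⟨G1, G2, G3⟩ := geometry (L := L) (M := M) (N := N) (f1 := f1) (f2 := f2) (κ := κ) hDo'
    (ha.mono hsub) (hb.mono hsub) (hc.mono hsub) (hw1.mono hsub) (hw2.mono hsub) (hΩ.mono hsub)
    (hP.mono hsub) (fun q hq => (hx q hq).2.2.1) (fun q hq => (hx q hq).2.2.2)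
    (fun q hq => r1 q (hsub hq)) (fun q hq => r2 q (hsub hq)) (fun q hq => e3 q (hsub hq))
    (fun q hq => e4 q (hsub hq)) (fun q hq => o1 q (hsub hq)) (fun q hq => o2 q (hsub hq))
    (fun q hq => by rw [o3 q (hsub hq)]; ring)
    (fun q hq => by
      have h := hmom1 q (hsubD hq)
      have h' : pdx2 M q = - pdx2 (fun r => u r * v r) q := pdx2_neg
      rw [h']; simp only [N, f1]; linarith)
    (fun q hq => by
      have h := hmom2 q (hsubD hq)
      have h' : pdx1 M q = - pdx1 (fun r => u r * v r) q := pdx1_neg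
      rw [h']; simp only [L, f2]; linarith)
    (fun q hq => by simp only [L, M, N, κ]; ring)
  exact ⟨W ∩ Metric.ball x₀ ε, min T ε, hWo, ⟨hx₀, Metric.mem_ball_self hε⟩,
    Set.inter_subset_left, lt_min hT hε, min_le_left _ _, _, _, _, D', hD',
    (ha.mul ha).mono hsub, (ha.mul hb).mono hsub, ((hb.mul hb).add (hc.mul hc)).mono hsub,
    G1, G2, G3⟩
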